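/- arXiv:2006.10344 — 3 statements merged into one kernel-verified Lean document; each statement's English description precedes it below -/
import Mathlib

section
/- Let p be a prime with p ≡ 1 (mod 4). Then the class number h_p of ℚ(√p) is odd. -/
open NumberField

theorem exists_sq_sub_prime_mul_sq_eq_neg_one {p : ℕ} (hp : p.Prime) (hp4 : p % 4 = 1) :
    ∃ a b : ℤ, a ^ 2 - p * b ^ 2 = -1 := by
  have hpZ : Prime (p : ℤ) := Nat.prime_iff_prime_int.mp hp
  obtain ⟨f, hf⟩ := Pell.IsFundamental.exists_of_not_isSquare (d := (p : ℤ))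
    (by exact_mod_cast hp.pos) hpZ.irreducible.not_isSquare
  have hx1 : 1 < f.x := hf.1
  have hprop : f.x ^ 2 - p * f.y ^ 2 = 1 := f.prop
  obtain ⟨k, hk⟩ : ∃ k : ℤ, (p : ℤ) = 4 * k + 1 := ⟨p / 4, by omega⟩
  have hxodd : ∃ m, f.x = 2 * m + 1 := by
    rcases Int.even_or_odd' f.x with ⟨m, h | h⟩
    · exfalso
      rcases Int.even_or_odd' f.y with ⟨n, h' | h'⟩ <;> rw [h, h', hk] at hprop <;>
        ring_nf at hprop <;> omega
    · exact ⟨m, h⟩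
  obtain ⟨m, hm⟩ := hxodd
  have hyeven : ∃ n, f.y = 2 * n := by
    rcases Int.even_or_odd' f.y with ⟨n, h | h⟩
    · exact ⟨n, h⟩
    · exfalso
      rw [hm, h, hk] at hprop
      ring_nf at hprop
      omega
  obtain ⟨n, hn⟩ := hyeven
  have hmul : m * (m + 1) = p * n ^ 2 := by
    rw [hm, hn] at hprop
    linarith
  have hmpos : 0 < m := by omega
  have hp0 : (0 : ℤ) < p := by exact_mod_cast hp.pos
  have eq_sq {x z : ℤ} (hx : 0 ≤ x) (h : x = z ^ 2 ∨ x = -z ^ 2) : ∃ w, x = w ^ 2 := by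
    rcases h with h | h
    · exact ⟨z, h⟩
    · exact ⟨0, by nlinarith [sq_nonneg z]⟩
  have hcop : IsCoprime m (m + 1) := ⟨-1, 1, by ring⟩
  rcases hpZ.dvd_or_dvd (Dvd.intro _ hmul.symm) with ⟨r, hr⟩ | ⟨r, hr⟩
  · exfalso
    have hrn : r * (m + 1) = n ^ 2 := by
      apply mul_left_cancel₀ hp0.ne'
      rw [← hmul, ← mul_assoc, ← hr]
    have hr0 : 0 ≤ r := by nlinarith
    have hcop' : IsCoprime r (m + 1) := hcop.of_isCoprime_of_dvd_left ⟨p, by rw [hr, mul_comm]⟩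
    obtain ⟨b, hb⟩ := (Int.sq_of_isCoprime hcop' hrn).elim fun _ h => eq_sq hr0 h
    obtain ⟨a, ha⟩ := (Int.sq_of_isCoprime hcop'.symm (by rw [mul_comm, hrn])).elim
      fun _ h => eq_sq (by omega : 0 ≤ m + 1) h
    have hle := hf.x_le_x (a := Pell.Solution₁.mk |a| b (by rw [sq_abs, ← ha, ← hb, ← hr]; ring))
      (by
        rw [Pell.Solution₁.x_mk]
        by_contra! h
        nlinarith [abs_nonneg a, sq_abs a])
    rw [Pell.Solution₁.x_mk] at hle
    nlinarith [sq_abs a, abs_nonneg a]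
  · have hrn : r * m = n ^ 2 := by
      apply mul_left_cancel₀ hp0.ne'
      rw [← hmul, ← mul_assoc, ← hr, mul_comm]
    have hr0 : 0 ≤ r := by nlinarith
    have hcop' : IsCoprime r m := hcop.symm.of_isCoprime_of_dvd_left ⟨p, by rw [hr, mul_comm]⟩
    obtain ⟨b, hb⟩ := (Int.sq_of_isCoprime hcop' hrn).elim fun _ h => eq_sq hr0 h
    obtain ⟨a, ha⟩ := (Int.sq_of_isCoprime hcop'.symm (by rw [mul_comm, hrn])).elim
      fun _ h => eq_sq hmpos.le h
    exact ⟨a, b, by rw [← ha, ← hb, ← hr]; ring⟩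

/-- If every nonzero `σ`-stable ideal is principal, `σ`-invariant units are `±1`, and there is a
unit of norm `-1`, then an ideal whose square is principal is itself principal. -/
theorem Ideal.isPrincipal_of_sq_isPrincipal_of_involution {R : Type*} [CommRing R]
    [IsDedekindDomain R] (σ : R ≃+* R) (hσ : ∀ x, σ (σ x) = x)
    (hstable : ∀ J : Ideal R, J ≠ ⊥ → J.map σ = J → J.IsPrincipal)
    (hunit : ∀ u : Rˣ, σ u = u → (u : R) = 1 ∨ (u : R) = -1)
    (hneg : ∃ ε : R, ε * σ ε = -1) {I : Ideal R} (hI : I ≠ ⊥) (hsq : (I ^ 2).IsPrincipal) :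
    I.IsPrincipal := by
  have map_map_self (J : Ideal R) : (J.map σ).map σ = J := by
    have h : (σ : R →+* R).comp (σ : R →+* R) = RingHom.id R := RingHom.ext hσ
    change (J.map (σ : R →+* R)).map (σ : R →+* R) = J
    rw [Ideal.map_map, h, Ideal.map_id]
  have map_span (x : R) : (Ideal.span {x}).map σ = Ideal.span {σ x} := by
    rw [Ideal.map_span, Set.image_singleton]
  have hI' : I.map σ ≠ ⊥ := fun h => hI (by rw [← map_map_self I, h, Ideal.map_bot])
  obtain ⟨c, hc⟩ := hsq
  obtain ⟨t, ht⟩ := hstable (I * I.map σ) (mul_ne_zero hI hI')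
    (by rw [Ideal.map_mul, map_map_self, mul_comm])
  change I ^ 2 = Ideal.span {c} at hc
  change I * I.map σ = Ideal.span {t} at ht
  have span_ne {x : R} {J : Ideal R} (hJ : J ≠ ⊥) (h : J = Ideal.span {x}) : x ≠ 0 := by
    rintro rfl
    exact hJ (by simpa using h)
  have hc0 : c ≠ 0 := span_ne (pow_ne_zero 2 hI) hc
  have ht0 : t ≠ 0 := span_ne (mul_ne_zero hI hI') ht
  have hct : Ideal.span {c} * I.map σ = Ideal.span {t} * I := by
    rw [← hc, ← ht]
    ring
  have hσ0 {x : R} (hx : x ≠ 0) : σ x ≠ 0 := by simpa using hx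
  -- `c` and `t` have the same norm up to sign
  have hassoc : Associated (t * σ t) (c * σ c) := by
    rw [← Ideal.span_singleton_eq_span_singleton]
    have h2 := congrArg (Ideal.map σ) hct
    rw [Ideal.map_mul, Ideal.map_mul, map_map_self, map_span, map_span] at h2
    apply mul_right_cancel₀ hI
    rw [← Ideal.span_singleton_mul_span_singleton, ← Ideal.span_singleton_mul_span_singleton]
    calc Ideal.span {t} * Ideal.span {σ t} * I = Ideal.span {σ t} * (Ideal.span {t} * I) := by ring
      _ = Ideal.span {c} * (Ideal.span {σ t} * I.map σ) := by rw [← hct]; ring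
      _ = Ideal.span {c} * Ideal.span {σ c} * I := by rw [← h2]; ring
  have hnorm : ∃ t' : R, t' * σ t' = c * σ c ∧ Ideal.span {t'} = Ideal.span {t} := by
    obtain ⟨u, hu⟩ := hassoc
    have hσu : σ u = u := by
      have h := congrArg σ hu
      simp only [map_mul, hσ] at h
      apply mul_left_cancel₀ (mul_ne_zero ht0 (hσ0 ht0))
      rw [hu, mul_comm t, h, mul_comm]
    rcases hunit u hσu with h | h
    · exact ⟨t, by rw [← hu, h, mul_one], rfl⟩
    · obtain ⟨ε, hε⟩ := hneg
      refine ⟨t * ε, ?_, ?_⟩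
      · rw [← hu, h, map_mul, ← hε]
        ring
      · exact Ideal.span_singleton_mul_right_unit (IsUnit.of_mul_eq_one (-σ ε) (by simp [hε])) t
  obtain ⟨t', hnorm, hspan⟩ := hnorm
  rw [← hspan] at hct
  have hcancel {x : R} (hx : x ≠ 0) {A B : Ideal R}
      (h : Ideal.span {x} * A = Ideal.span {x} * B) : A = B :=
    mul_left_cancel₀ (by simpa using hx) h
  by_cases hsum : c + t' = 0
  · have : t' = -c := by linear_combination hsum
    rw [this, Ideal.span_singleton_neg] at hct
    exact hstable I hI (hcancel hc0 hct)
  · set γ := σ c * (c + t') with hγ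
    have hγ0 : γ ≠ 0 := mul_ne_zero (hσ0 hc0) hsum
    have hγt : σ γ * t' = c * γ := by
      simp only [hγ, map_mul, map_add, hσ]
      linear_combination c * hnorm
    have hJ : (Ideal.span {γ} * I).map σ = Ideal.span {γ} * I := by
      rw [Ideal.map_mul, map_span]
      apply hcancel hc0
      calc Ideal.span {c} * (Ideal.span {σ γ} * I.map σ)
          = Ideal.span {σ γ} * (Ideal.span {c} * I.map σ) := by ring
        _ = Ideal.span {σ γ} * Ideal.span {t'} * I := by rw [hct]; ring
        _ = Ideal.span {c} * (Ideal.span {γ} * I) := by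
          rw [Ideal.span_singleton_mul_span_singleton, hγt,
            ← Ideal.span_singleton_mul_span_singleton, mul_assoc]
    obtain ⟨δ, hδ⟩ := hstable _ (mul_ne_zero (by simpa using hγ0) hI) hJ
    change _ = Ideal.span {δ} at hδ
    obtain ⟨i, -, rfl⟩ := Ideal.mem_span_singleton_mul.mp
      (hδ.symm ▸ Ideal.mem_span_singleton_self δ : δ ∈ Ideal.span {γ} * I)
    exact ⟨i, hcancel hγ0 (by rw [hδ, Ideal.span_singleton_mul_span_singleton])⟩

/-- In `ℤ[ω]` with `ω² = ω + k` and `p = 4k + 1` prime, a nonzero ideal stable under the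
conjugation `ω ↦ 1 - ω` is principal. -/
theorem Ideal.isPrincipal_of_map_conj_eq {R : Type*} [CommRing R]
    [IsDedekindDomain R] (σ : R ≃+* R) {ω : R} {k p : ℤ} (hp : Prime p) (hpk : p = 4 * k + 1)
    (hω : ω ^ 2 = ω + k) (hσω : σ ω = 1 - ω)
    (hspan : ∀ x : R, ∃ u v : ℤ, x = u + v * ω)
    (hindep : ∀ u v : ℤ, (u + v * ω : R) = 0 → u = 0 ∧ v = 0)
    {J : Ideal R} (hJ0 : J ≠ ⊥) (hJ : J.map σ = J) : J.IsPrincipal := by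
  have hinj {u v u' v' : ℤ} (h : (u + v * ω : R) = u' + v' * ω) : u = u' ∧ v = v' := by
    have := hindep (u - u') (v - v') (by push_cast; linear_combination h)
    omega
  have hJσ {x : R} (hx : x ∈ J) : σ x ∈ J := hJ ▸ Ideal.mem_map_of_mem σ hx
  let V : Ideal ℤ :=
    { carrier := {v | ∃ u : ℤ, (u + v * ω : R) ∈ J}
      zero_mem' := ⟨0, by simp⟩
      add_mem' := by
        rintro v v' ⟨u, h⟩ ⟨u', h'⟩
        refine ⟨u + u', ?_⟩
        convert J.add_mem h h' using 1
        push_cast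
        ring
      smul_mem' := by
        rintro n v ⟨u, h⟩
        refine ⟨n * u, ?_⟩
        convert J.mul_mem_left (n : R) h using 1
        push_cast [smul_eq_mul]
        ring }
  obtain ⟨d, hd⟩ := (IsPrincipalIdealRing.principal V)
  change V = Ideal.span {d} at hd
  have hdvd {u v : ℤ} (h : (u + v * ω : R) ∈ J) : d ∣ u ∧ d ∣ v := by
    have h1 : v ∈ V := ⟨u, h⟩
    have h2 : u + v ∈ V := by
      refine ⟨v * k, ?_⟩
      convert J.mul_mem_left ω h using 1
      push_cast
      linear_combination (-v : R) * hω
    rw [hd, Ideal.mem_span_singleton] at h1 h2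
    exact ⟨(Int.dvd_iff_dvd_of_dvd_add h2).mpr h1, h1⟩
  have hd0 : (d : R) ≠ 0 := by
    intro h
    obtain rfl : d = 0 := (hindep d 0 (by simpa using h)).1
    refine hJ0 (eq_bot_iff.mpr fun x hx => ?_)
    obtain ⟨u, v, rfl⟩ := hspan x
    obtain ⟨hu, hv⟩ := hdvd hx
    rw [zero_dvd_iff] at hu hv
    simp [hu, hv]
  obtain ⟨J', rfl⟩ : Ideal.span {(d : R)} ∣ J := by
    rw [Ideal.dvd_iff_le]
    intro x hx
    obtain ⟨u, v, rfl⟩ := hspan x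
    obtain ⟨⟨u, rfl⟩, ⟨v, rfl⟩⟩ := hdvd hx
    exact Ideal.mem_span_singleton.mpr ⟨u + v * ω, by push_cast; ring⟩
  have hmem {z : R} (h : d * z ∈ Ideal.span {(d : R)} * J') : z ∈ J' := by
    obtain ⟨w, hw, hwz⟩ := Ideal.mem_span_singleton_mul.mp h
    rwa [← mul_left_cancel₀ hd0 hwz]
  suffices J'.IsPrincipal by
    obtain ⟨j, rfl⟩ := this
    exact ⟨d * j, Ideal.span_singleton_mul_span_singleton _ _⟩
  -- the primitive part contains `√p`
  have hs : 2 * ω - 1 ∈ J' := by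
    obtain ⟨u, hu⟩ : d ∈ V := hd ▸ Ideal.mem_span_singleton_self d
    obtain ⟨u, rfl⟩ := (hdvd hu).1
    apply hmem
    convert Ideal.sub_mem _ hu (hJσ hu) using 1
    simp only [map_add, map_mul, map_intCast, hσω]
    ring
  have hp_eq : (p : R) = (2 * ω - 1) * (2 * ω - 1) := by
    rw [hpk]
    push_cast
    linear_combination (-4 : R) * hω
  have hpmem : (p : R) ∈ J' := hp_eq ▸ J'.mul_mem_left _ hs
  by_cases h : ∀ u v : ℤ, (u + v * ω : R) ∈ J' → p ∣ 2 * u + v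
  · refine ⟨2 * ω - 1, le_antisymm (fun x hx => ?_) ?_⟩
    · obtain ⟨u, v, rfl⟩ := hspan x
      obtain ⟨q, hq⟩ := h u v hx
      have hq' : (2 * u + v : R) = p * q := by exact_mod_cast congrArg (Int.cast (R := R)) hq
      refine Ideal.mem_span_singleton.mpr
        ⟨(2 * ω - 1) * (u + v * ω) - 2 * k * ((2 * ω - 1) * q + v), ?_⟩
      have hpk' : (p : R) = 4 * k + 1 := by rw [hpk]; push_cast; ring
      linear_combination (u + v * ω - 2 * k * q : R) * hp_eq - (u + v * ω) * hpk' - 2 * k * hq'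
    · exact (Ideal.span_singleton_le_iff_mem _).mpr hs
  · push Not at h
    obtain ⟨u, v, huv, hndvd⟩ := h
    have h1 : ((2 * u + v : ℤ) : R) ∈ J' := by
      convert J'.sub_mem (J'.mul_mem_left 2 huv) (J'.mul_mem_left (v : R) hs) using 1
      push_cast
      ring
    obtain ⟨a, b, hab⟩ := (hp.coprime_iff_not_dvd.mpr hndvd)
    have : J' = ⊤ := by
      rw [Ideal.eq_top_iff_one]
      convert J'.add_mem (J'.mul_mem_left (a : R) hpmem) (J'.mul_mem_left (b : R) h1) using 1
      exact_mod_cast congrArg (Int.cast (R := R)) hab.symm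
    exact this ▸ ⟨1, by simp⟩

/-- If a Dedekind domain is generated over `ℤ` by `ω` with `ω² = ω + k` and `p = 4k + 1` prime,
then an ideal whose square is principal is itself principal. -/
theorem Ideal.isPrincipal_of_sq_isPrincipal_of_quadratic {R : Type*} [CommRing R]
    [IsDedekindDomain R] (σ : R ≃+* R) {ω : R} {k : ℤ} {p : ℕ} (hp : p.Prime)
    (hpk : (p : ℤ) = 4 * k + 1) (hω : ω ^ 2 = ω + k) (hσω : σ ω = 1 - ω)
    (hspan : ∀ x : R, ∃ u v : ℤ, x = u + v * ω)
    (hindep : ∀ u v : ℤ, (u + v * ω : R) = 0 → u = 0 ∧ v = 0)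
    {I : Ideal R} (hI : I ≠ ⊥) (hsq : (I ^ 2).IsPrincipal) : I.IsPrincipal := by
  have hcast {n : ℤ} (h : (n : R) = 0) : n = 0 := (hindep n 0 (by simpa using h)).1
  have hfixed {x : R} (hx : σ x = x) : ∃ u : ℤ, x = u := by
    obtain ⟨u, v, rfl⟩ := hspan x
    simp only [map_add, map_mul, map_intCast, hσω] at hx
    obtain ⟨-, h⟩ := hindep (-v) (2 * v) (by push_cast; linear_combination -hx)
    obtain rfl : v = 0 := by omega
    exact ⟨u, by simp⟩
  refine isPrincipal_of_sq_isPrincipal_of_involution σ (fun x => ?_)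
    (fun J hJ0 hJ => isPrincipal_of_map_conj_eq σ (Nat.prime_iff_prime_int.mp hp) hpk hω hσω
      hspan hindep hJ0 hJ) (fun u hu => ?_) ?_ hI hsq
  · obtain ⟨u, v, rfl⟩ := hspan x
    simp [hσω]
  · obtain ⟨a, ha⟩ := hfixed hu
    obtain ⟨b, hb⟩ := hfixed (x := ((u⁻¹ : Rˣ) : R)) (by
      apply u.isUnit.mul_left_cancel
      conv_lhs => rw [← hu]
      rw [← map_mul, Units.mul_inv, map_one])
    have hab : a * b = 1 := by
      apply sub_eq_zero.mp ∘ hcast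
      push_cast
      rw [← ha, ← hb, Units.mul_inv, sub_self]
    rcases Int.eq_one_or_neg_one_of_mul_eq_one hab with rfl | rfl <;> simp [ha]
  · obtain ⟨a, b, hab⟩ := exists_sq_sub_prime_mul_sq_eq_neg_one hp (by omega)
    refine ⟨a + b * (2 * ω - 1), ?_⟩
    have h : (a ^ 2 - (4 * k + 1) * b ^ 2 : R) = -1 := by
      rw [hpk] at hab
      exact_mod_cast congrArg (Int.cast (R := R)) hab
    simp only [map_add, map_sub, map_mul, map_intCast, map_ofNat, map_one, hσω]
    linear_combination h - 4 * b ^ 2 * hω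

theorem ClassGroup.odd_card_of_sq_isPrincipal {R : Type*} [CommRing R] [IsDedekindDomain R]
    [Fintype (ClassGroup R)]
    (h : ∀ I : Ideal R, I ≠ ⊥ → (I ^ 2).IsPrincipal → I.IsPrincipal) :
    Odd (Fintype.card (ClassGroup R)) := by
  rw [← Nat.not_even_iff_odd, even_iff_two_dvd]
  intro h2
  obtain ⟨x, hx⟩ := exists_prime_orderOf_dvd_card 2 h2
  obtain ⟨⟨I, hI⟩, rfl⟩ := ClassGroup.mk0_surjective x
  have hsq := pow_orderOf_eq_one (ClassGroup.mk0 ⟨I, hI⟩)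
  rw [hx, ← map_pow] at hsq
  have hone := (ClassGroup.mk0_eq_one_iff hI).mpr
    (h I (mem_nonZeroDivisors_iff_ne_zero.mp hI) ((ClassGroup.mk0_eq_one_iff (pow_mem hI 2)).mp hsq))
  rw [hone, orderOf_one] at hx
  omega

theorem Rat.exists_int_eq_of_isIntegral {K : Type*} [Field K] [CharZero K] {q : ℚ}
    (h : IsIntegral ℤ (q : K)) : ∃ n : ℤ, q = n := by
  have h' : IsIntegral ℤ q :=
    (isIntegral_algHom_iff (Algebra.ofId ℚ K |>.restrictScalars ℤ) (algebraMap ℚ K).injective).mp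
      (by simpa using h)
  obtain ⟨n, hn⟩ := IsIntegrallyClosed.isIntegral_iff.mp h'
  exact ⟨n, by simpa using hn.symm⟩

/-- If `p` is prime and `p b²` is an integer for rational `b`, then `b` is an integer. -/
theorem Rat.exists_int_eq_of_prime_mul_sq {p : ℕ} (hp : p.Prime) {b : ℚ} {n : ℤ}
    (h : p * b ^ 2 = n) : ∃ m : ℤ, b = m := by
  have hsq : (p * b) ^ 2 = ((p * n : ℤ) : ℚ) := by
    push_cast
    rw [← h]
    ring
  have hint : IsIntegral ℤ (p * b : ℚ) := by
    refine IsIntegral.of_pow (n := 2) two_pos ?_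
    rw [hsq]
    exact isIntegral_algebraMap (R := ℤ)
  obtain ⟨c, hc⟩ := IsIntegrallyClosed.isIntegral_iff.mp hint
  have hc : (c : ℚ) = p * b := by simpa using hc
  rw [← hc] at hsq
  have hcn : c ^ 2 = p * n := by exact_mod_cast hsq
  obtain ⟨m, rfl⟩ := (Nat.prime_iff_prime_int.mp hp).dvd_of_dvd_pow (Dvd.intro _ hcn.symm)
  refine ⟨m, mul_left_cancel₀ (Nat.cast_ne_zero.mpr hp.ne_zero : (p : ℚ) ≠ 0) ?_⟩
  rw [← hc]
  push_cast
  ring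

/-- If `p ≡ 1 (mod 4)` is prime, then the class number of `ℚ(√p)` is odd. -/
theorem stmt_2 (p : ℕ) (hp : p.Prime) (hp4 : p % 4 = 1)
    (K : Type) [Field K] [NumberField K] (α : K) (hα : α ^ 2 = (p : K))
    (hdeg : Module.finrank ℚ K = 2) :
    Odd (classNumber K) := by
  have hirr (q : ℚ) : (q : K) ≠ α := by
    rintro rfl
    have h : q * q = p := by
      rw [← sq]
      exact_mod_cast hα
    exact (Nat.prime_iff.mp hp).irreducible.not_isSquare (Rat.isSquare_natCast_iff.mp ⟨q, h.symm⟩)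
  have hindep : ∀ r s : ℚ, (r + s * α : K) = 0 → r = 0 ∧ s = 0 := by
    intro r s h
    have hs : s = 0 := by
      by_contra hs
      have hs' : (s : K) ≠ 0 := by exact_mod_cast hs
      refine hirr (-r / s) ?_
      push_cast
      field_simp
      linear_combination -h
    subst hs
    exact ⟨by simpa using h, rfl⟩
  have hspan (x : K) : ∃ r s : ℚ, x = r + s * α := by
    have hli : LinearIndependent ℚ ![1, α] := by
      rw [LinearIndependent.pair_iff]
      intro r s h
      exact hindep r s (by simpa [Algebra.smul_def] using h)
    have htop := hli.span_eq_top_of_card_eq_finrank (by simp [hdeg])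
    have hx : x ∈ Submodule.span ℚ (Set.range ![1, α]) := htop ▸ Submodule.mem_top
    rw [Matrix.range_cons_cons_empty, Submodule.mem_span_pair] at hx
    obtain ⟨r, s, rfl⟩ := hx
    exact ⟨r, s, by simp [Algebra.smul_def]⟩
  have : Algebra.IsQuadraticExtension ℚ K := ⟨hdeg⟩
  obtain ⟨τ, hτ⟩ : ∃ τ : K ≃ₐ[ℚ] K, τ α ≠ α := by
    by_contra! h
    obtain ⟨q, hq⟩ := IntermediateField.mem_bot.mp ((IsGalois.mem_bot_iff_fixed α).mpr h)
    exact hirr q (by simpa using hq)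
  have hτα : τ α = -α := by
    refine (sq_eq_sq_iff_eq_or_eq_neg.mp ?_).resolve_left hτ
    rw [← map_pow, hα, map_natCast]
  obtain ⟨k, hk⟩ : ∃ k : ℤ, (p : ℤ) = 4 * k + 1 := ⟨p / 4, by omega⟩
  have hpk : (p : K) = 4 * k + 1 := by exact_mod_cast congrArg (Int.cast (R := K)) hk
  have hω : IsIntegral ℤ ((1 + α) / 2) := by
    refine ⟨Polynomial.X ^ 2 - Polynomial.X - Polynomial.C k, by monicity!, ?_⟩
    simp only [Polynomial.eval₂_sub, Polynomial.eval₂_X_pow, Polynomial.eval₂_X,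
      Polynomial.eval₂_C]
    simp only [algebraMap_int_eq, eq_intCast]
    linear_combination (hα + hpk) / 4
  let ω : 𝓞 K := ⟨(1 + α) / 2, hω⟩
  have hωK : (ω : K) = (1 + α) / 2 := rfl
  have hspanO (x : 𝓞 K) : ∃ u v : ℤ, x = u + v * ω := by
    obtain ⟨r, s, hx⟩ := hspan x
    have hxint : IsIntegral ℤ (x : K) := x.2
    have hτint : IsIntegral ℤ (τ x) := hxint.map (τ.restrictScalars ℤ)
    have hτx : τ x = r - s * α := by rw [hx]; simp [hτα, sub_eq_add_neg]
    obtain ⟨a, ha⟩ := Rat.exists_int_eq_of_isIntegral (K := K) (q := 2 * r) (by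
      have h : ((2 * r : ℚ) : K) = x + τ x := by
        rw [hτx, hx]
        push_cast
        ring
      rw [h]
      exact hxint.add hτint)
    obtain ⟨N, hN⟩ := Rat.exists_int_eq_of_isIntegral (K := K) (q := r ^ 2 - p * s ^ 2) (by
      have h : ((r ^ 2 - p * s ^ 2 : ℚ) : K) = x * τ x := by
        rw [hτx, hx]
        push_cast
        linear_combination (s : K) ^ 2 * hα
      rw [h]
      exact hxint.mul hτint)
    obtain ⟨b, hb⟩ := Rat.exists_int_eq_of_prime_mul_sq hp (b := 2 * s) (n := a ^ 2 - 4 * N) (by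
      push_cast
      rw [← ha, ← hN]
      ring)
    have hab : a ^ 2 - (4 * k + 1) * b ^ 2 = 4 * N := by
      rw [← hk]
      have : (a ^ 2 - p * b ^ 2 : ℚ) = 4 * N := by
        rw [← ha, ← hb, ← hN]
        ring
      exact_mod_cast this
    obtain ⟨u, hu⟩ : ∃ u, a = b + 2 * u := by
      rcases Int.even_or_odd' a with ⟨a, rfl | rfl⟩ <;>
        rcases Int.even_or_odd' b with ⟨b, rfl | rfl⟩ <;> ring_nf at hab
      · exact ⟨a - b, by ring⟩
      · omega
      · omega
      · exact ⟨a - b, by ring⟩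
    refine ⟨u, b, RingOfIntegers.ext ?_⟩
    have hr : (2 * r : K) = a := by exact_mod_cast congrArg (Rat.cast (K := K)) ha
    have hs : (2 * s : K) = b := by exact_mod_cast congrArg (Rat.cast (K := K)) hb
    have hu' : (a : K) = b + 2 * u := by exact_mod_cast congrArg (Int.cast (R := K)) hu
    simp only [map_add, map_mul, map_intCast, hωK, hx]
    linear_combination hr / 2 + hs / 2 * α + hu' / 2
  refine ClassGroup.odd_card_of_sq_isPrincipal fun I hI hsq =>
    Ideal.isPrincipal_of_sq_isPrincipal_of_quadratic (RingOfIntegers.mapRingEquiv τ.toRingEquiv)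
      (ω := ω) hp hk (RingOfIntegers.ext ?_) (RingOfIntegers.ext ?_) hspanO (fun u v h => ?_) hI hsq
  · simp only [map_add, map_pow, map_intCast, hωK]
    linear_combination (hα + hpk) / 4
  · rw [RingOfIntegers.mapRingEquiv_apply]
    simp only [map_sub, map_one, hωK]
    change τ ((1 + α) / 2) = _
    simp only [map_div₀, map_add, map_one, map_ofNat, hτα]
    ring
  · have hK := congrArg (algebraMap (𝓞 K) K) h
    simp only [map_add, map_mul, map_intCast, hωK, map_zero] at hK
    obtain ⟨h1, h2⟩ := hindep (u + v / 2) (v / 2) (by push_cast; linear_combination hK)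
    obtain rfl : v = 0 := by exact_mod_cast (div_eq_zero_iff.mp h2).resolve_right two_ne_zero
    exact ⟨by simpa using h1, rfl⟩
end

section
/- Let p ≡ 1 (mod 4) be prime and q a prime with q ∤ 2p inert in ℚ(√p)/ℚ. Then ord(ε_p mod qO_K) ≡ 4 (mod 8) if q ≡ 1 (mod 4), and ord(ε_p mod qO_K) ≡ 0 (mod 8) if q ≡ 3 (mod 4). -/
open NumberField

/-- If `x ^ (q + 1) = -1 ≠ 1`, then `2 * (q + 1)` is an odd multiple of the order of `x`. -/
theorem exists_odd_two_mul_succ_eq_orderOf_mul {R : Type*} [CommRing R] {x : R} {q : ℕ}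
    (hx : x ^ (q + 1) = -1) (h : (-1 : R) ≠ 1) :
    ∃ c, c % 2 = 1 ∧ 2 * (q + 1) = orderOf x * c := by
  obtain ⟨c, hc⟩ : orderOf x ∣ 2 * (q + 1) :=
    orderOf_dvd_of_pow_eq_one (by rw [mul_comm, pow_mul, hx]; norm_num)
  refine ⟨c, ?_, hc⟩
  by_contra hodd
  obtain ⟨e, rfl⟩ : ∃ e, c = 2 * e := ⟨c / 2, by omega⟩
  have hdvd : orderOf x ∣ q + 1 := ⟨e, by linarith⟩
  exact h (hx ▸ orderOf_dvd_iff_pow_eq_one.mp hdvd)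

/-- A finite domain all of whose elements are fixed by the `q`-th power map has at most `q`
elements. -/
theorem card_le_of_forall_pow_eq_self {R : Type*} [CommRing R] [IsDomain R] [Finite R] {q : ℕ}
    (hq : 1 < q) (h : ∀ y : R, y ^ q = y) : Nat.card R ≤ q := by
  have := Fintype.ofFinite R
  have hdeg : (Polynomial.X ^ q - Polynomial.X : Polynomial R).natDegree = q := by
    rw [Polynomial.natDegree_sub_eq_left_of_natDegree_lt] <;> simp [hq]
  have hne : (Polynomial.X ^ q - Polynomial.X : Polynomial R) ≠ 0 :=
    Polynomial.ne_zero_of_natDegree_gt (hdeg.symm ▸ hq)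
  have hle := Polynomial.card_le_degree_of_subset_roots
    (p := (Polynomial.X ^ q - Polynomial.X : Polynomial R)) (Z := Finset.univ) (fun y _ ↦ by
      rw [Polynomial.mem_roots hne]
      simp [h])
  rwa [hdeg, Finset.card_univ, ← Nat.card_eq_fintype_card] at hle

/-- If a rational prime `q` stays prime in a quadratic field, then the nontrivial automorphism
is congruent to the `q`-th power map modulo `q`. -/
theorem exists_galois_ne_one_pow_eq {K : Type*} [Field K] [NumberField K]
    (hdeg : Module.finrank ℚ K = 2) [IsGalois ℚ K] {q : ℕ} (hq : q.Prime)
    (hinert : Prime (q : 𝓞 K)) :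
    ∃ σ : Gal(K/ℚ), σ ≠ 1 ∧ ∀ x : 𝓞 K,
      Ideal.Quotient.mk (Ideal.span {(q : 𝓞 K)}) (σ • x) =
        Ideal.Quotient.mk (Ideal.span {(q : 𝓞 K)}) x ^ q := by
  set Q : Ideal (𝓞 K) := Ideal.span {(q : 𝓞 K)} with hQ
  have hQp : Q.IsPrime := (Ideal.span_singleton_prime hinert.ne_zero).mpr hinert
  have hcard : Nat.card (𝓞 K ⧸ Q) = q ^ 2 := by
    rw [← Submodule.cardQuot_apply, ← Ideal.absNorm_apply, hQ, Ideal.absNorm_span_natCast,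
      RingOfIntegers.rank, hdeg]
  have hfin : Finite (𝓞 K ⧸ Q) :=
    Nat.finite_of_card_ne_zero (by rw [hcard]; exact pow_ne_zero _ hq.ne_zero)
  have hunder : Q.under ℤ = Ideal.span {(q : ℤ)} := by
    have hmax : (Ideal.span {(q : ℤ)}).IsMaximal :=
      PrincipalIdealRing.isMaximal_of_irreducible (Nat.prime_iff_prime_int.mp hq).irreducible
    refine (hmax.eq_of_le (Ideal.IsPrime.under ℤ Q).ne_top ?_).symm
    rw [Ideal.span_singleton_le_iff_mem, Ideal.mem_comap]
    rw [eq_intCast, Int.cast_natCast]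
    exact Ideal.mem_span_singleton_self (q : 𝓞 K)
  obtain ⟨σ, hσ⟩ := IsArithFrobAt.exists_of_isInvariant ℤ Gal(K/ℚ) Q
  have hpow : ∀ x : 𝓞 K, Ideal.Quotient.mk Q (σ • x) = Ideal.Quotient.mk Q x ^ q := by
    intro x
    have h := hσ x
    rw [hunder, Int.card_ideal_quot] at h
    rw [← map_pow]
    exact Ideal.Quotient.eq.mpr h
  refine ⟨σ, ?_, hpow⟩
  rintro rfl
  have hroot : ∀ y : 𝓞 K ⧸ Q, y ^ q = y := fun y ↦ by
    obtain ⟨x, rfl⟩ := Ideal.Quotient.mk_surjective y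
    rw [← hpow, one_smul]
  have hle := card_le_of_forall_pow_eq_self hq.one_lt hroot
  rw [hcard] at hle
  nlinarith [hq.two_le]

/-- In a real quadratic field of prime discriminant, every fundamental unit has norm `-1`. -/
theorem mul_galois_fundamental_unit_eq_neg_one {p : ℕ} (hp : p.Prime) (hp4 : p % 4 = 1)
    {K : Type*} [Field K] [NumberField K] [IsGalois ℚ K] {α : K} (hα : α ^ 2 = (p : K))
    (hdeg : Module.finrank ℚ K = 2) {ε : (𝓞 K)ˣ}
    (hfund : ∀ u : (𝓞 K)ˣ, ∃ n : ℤ, u = ε ^ n ∨ u = -ε ^ n)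
    {σ : Gal(K/ℚ)} (hσ : σ ≠ 1) : (ε : 𝓞 K) * σ • (ε : 𝓞 K) = -1 := by
  classical
  have huniv : (Finset.univ : Finset Gal(K/ℚ)) = {1, σ} := by
    symm
    apply Finset.eq_univ_of_card
    rw [Finset.card_pair hσ.symm, ← Nat.card_eq_fintype_card, IsGalois.card_aut_eq_finrank, hdeg]
  have hαint : IsIntegral ℤ α := by
    refine IsIntegral.of_pow two_pos ?_
    rw [hα]
    exact isIntegral_natCast p
  have hσα : σ α = -α := by
    have hsq : σ α ^ 2 = α ^ 2 := by rw [← map_pow, hα, map_natCast]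
    rcases sq_eq_sq_iff_eq_or_eq_neg.mp hsq with h | h
    · exfalso
      obtain ⟨r, hr⟩ := (IsGalois.mem_range_algebraMap_iff_fixed (F := ℚ) α).mpr (fun τ ↦ by
        have : τ ∈ ({1, σ} : Finset Gal(K/ℚ)) := huniv ▸ Finset.mem_univ τ
        rcases Finset.mem_insert.mp this with rfl | hτ
        · rfl
        · rw [Finset.mem_singleton.mp hτ, h])
      have hr2 : r ^ 2 = p := by
        apply (algebraMap ℚ K).injective
        rw [map_pow, hr, hα, map_natCast]
      have : IsSquare (p : ℚ) := ⟨r, by rw [← hr2, sq]⟩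
      rw [Rat.isSquare_natCast_iff] at this
      exact hp.prime.irreducible.not_isSquare this
    · exact h
  obtain ⟨a, b, hab⟩ := exists_sq_sub_prime_mul_sq_eq_neg_one hp hp4
  let A : 𝓞 K := ⟨α, hαint⟩
  have hA2 : A ^ 2 = (p : 𝓞 K) := RingOfIntegers.ext hα
  have hσA : σ • A = -A := RingOfIntegers.ext hσα
  have habO : (a : 𝓞 K) ^ 2 - p * b ^ 2 = -1 := by exact_mod_cast congrArg (Int.cast : ℤ → 𝓞 K) hab
  have hmul : (a + b * A) * (-(a - b * A)) = 1 := by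
    linear_combination (b : 𝓞 K) ^ 2 * hA2 - habO
  let u : (𝓞 K)ˣ := Units.mkOfMulEqOne _ _ hmul
  let f : (𝓞 K)ˣ →* (𝓞 K)ˣ :=
    MonoidHom.id _ * Units.map (MulSemiringAction.toRingHom Gal(K/ℚ) (𝓞 K) σ : 𝓞 K →* 𝓞 K)
  have hf : ∀ v : (𝓞 K)ˣ, (f v : 𝓞 K) = v * σ • (v : 𝓞 K) := fun v ↦ rfl
  have hfu : f u = -1 := by
    apply Units.ext
    have hbar : σ • (a + b * A) = a - b * A := by
      have h := map_intCast (MulSemiringAction.toRingHom Gal(K/ℚ) (𝓞 K) σ)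
      simp only [MulSemiringAction.toRingHom_apply] at h
      rw [smul_add, smul_mul', h, h, hσA]
      ring
    rw [hf]
    change (a + b * A) * σ • (a + b * A) = -1
    rw [hbar]
    linear_combination -hmul
  have hfneg : ∀ v, f (-v) = f v := fun v ↦ Units.ext (by simp [hf])
  have hfε : f ε = 1 ∨ f ε = -1 := by
    have hN : ((f ε : 𝓞 K) : K) = algebraMap ℚ K (Algebra.norm ℚ (ε : K)) := by
      rw [Algebra.norm_eq_prod_automorphisms, huniv, Finset.prod_pair hσ.symm, hf]
      rfl
    have habs := NumberField.isUnit_iff_norm.mp ε.isUnit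
    rw [RingOfIntegers.coe_norm] at habs
    rcases eq_or_eq_neg_of_abs_eq habs with h | h
    · left
      exact Units.ext (RingOfIntegers.ext (by rw [hN, h]; simp))
    · right
      exact Units.ext (RingOfIntegers.ext (by rw [hN, h]; simp))
  rcases hfε with h | h
  · exfalso
    obtain ⟨n, hn⟩ := hfund u
    have h1 : f u = 1 := by
      rcases hn with hn | hn
      · rw [hn, map_zpow, h, one_zpow]
      · rw [hn, hfneg, map_zpow, h, one_zpow]
    have h2 : (-1 : 𝓞 K) = 1 := by simpa using congrArg Units.val (hfu.symm.trans h1)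
    norm_num at h2
  · rw [← hf, h]
    rfl

/-- If `p ≡ 1 (mod 4)` is prime and `q ∤ 2p` is inert in `ℚ(√p)/ℚ`, then
`ord(ε_p mod qO_K) ≡ 4 (mod 8)` if `q ≡ 1 (mod 4)`, and
`ord(ε_p mod qO_K) ≡ 0 (mod 8)` if `q ≡ 3 (mod 4)`. -/
theorem stmt_4 (p q : ℕ) (hp : p.Prime) (hp4 : p % 4 = 1)
    (hq : q.Prime) (hq2p : ¬ q ∣ 2 * p)
    (K : Type) [Field K] [NumberField K] (α : K) (hα : α ^ 2 = (p : K))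
    (hdeg : Module.finrank ℚ K = 2)
    (ε : (𝓞 K)ˣ)
    (hfund : ∀ u : (𝓞 K)ˣ, ∃ n : ℤ, u = ε ^ n ∨ u = -ε ^ n)
    (hinert : Prime (q : 𝓞 K)) :
    (q % 4 = 1 →
      orderOf (Ideal.Quotient.mk (Ideal.span {(q : 𝓞 K)}) (ε : 𝓞 K)) % 8 = 4) ∧
    (q % 4 = 3 →
      orderOf (Ideal.Quotient.mk (Ideal.span {(q : 𝓞 K)}) (ε : 𝓞 K)) % 8 = 0) := by
  have : Algebra.IsQuadraticExtension ℚ K := ⟨hdeg⟩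
  obtain ⟨σ, hσ, hfrob⟩ := exists_galois_ne_one_pow_eq hdeg hq hinert
  have hnorm := mul_galois_fundamental_unit_eq_neg_one hp hp4 hα hdeg hfund hσ
  have hpow : Ideal.Quotient.mk (Ideal.span {(q : 𝓞 K)}) (ε : 𝓞 K) ^ (q + 1) = -1 := by
    rw [pow_succ', ← hfrob, ← map_mul, hnorm, map_neg, map_one]
  have hne : (-1 : 𝓞 K ⧸ Ideal.span {(q : 𝓞 K)}) ≠ 1 := by
    intro h
    have h2 : Ideal.Quotient.mk (Ideal.span {(q : 𝓞 K)}) (2 : 𝓞 K) = 0 := by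
      rw [map_ofNat]
      linear_combination -h
    rw [Ideal.Quotient.eq_zero_iff_dvd] at h2
    have hcop : IsCoprime (q : ℤ) 2 := by
      rw [← Nat.cast_ofNat (R := ℤ) (n := 2), Nat.isCoprime_iff_coprime]
      exact hq.coprime_iff_not_dvd.mpr fun hd ↦ hq2p (hd.mul_right p)
    have hcopO := hcop.map (Int.castRingHom (𝓞 K))
    simp only [eq_intCast, Int.cast_natCast, Int.cast_ofNat] at hcopO
    exact hinert.not_isUnit (hcopO.isUnit_of_dvd' dvd_rfl h2)
  obtain ⟨c, hc, heq⟩ := exists_odd_two_mul_succ_eq_orderOf_mul hpow hne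
  generalize orderOf (Ideal.Quotient.mk (Ideal.span {(q : 𝓞 K)}) (ε : 𝓞 K)) = d at heq ⊢
  have hmod : (d % 8) * (c % 8) % 8 = 2 * (q + 1) % 8 := by rw [← Nat.mul_mod, heq]
  have hd8 : d % 8 < 8 := Nat.mod_lt _ (by norm_num)
  have hc8 : c % 8 = 1 ∨ c % 8 = 3 ∨ c % 8 = 5 ∨ c % 8 = 7 := by omega
  constructor <;> intro hq4 <;> rcases hc8 with h | h | h | h <;> rw [h] at hmod <;> omega
end

section
/- Let p ≡ 1 (mod 4) be prime. Then the number of integers r with p/4 < r < p/2 that are quadratic residues modulo p equals (1/4)[(p-1)/2 - h(-p)], where h(-p) is the class number of ℚ(√-p). -/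
open NumberField

open Polynomial in
/-- The operator `X * d/dX` on polynomials. -/
noncomputable def eulerOp (R : Type*) [CommRing R] : R[X] →ₗ[R] R[X] :=
  LinearMap.mulLeft R X ∘ₗ derivative

section EulerOp
open Polynomial
variable {R : Type*} [CommRing R]

lemma eulerOp_apply (f : R[X]) : eulerOp R f = X * derivative f := rfl

lemma eulerOp_pow_X_pow (n j : ℕ) : (eulerOp R ^ n) (X ^ j) = (j : R) ^ n • X ^ j := by
  induction n with
  | zero => simp
  | succ n ih =>
    have h : eulerOp R (X ^ j) = (j : R) • X ^ j := by
      rw [eulerOp_apply, derivative_X_pow, smul_eq_C_mul]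
      rcases j with _ | j
      · simp
      · simp only [Nat.add_sub_cancel]; ring
    rw [pow_succ', Module.End.mul_apply, ih, map_smul, h, smul_smul, pow_succ]

lemma eval_one_eulerOp_pow (n : ℕ) : ∀ q : R[X],
    ((eulerOp R ^ n) ((X - 1) ^ n * q)).eval 1 = (n.factorial : R) * q.eval 1 := by
  induction n with
  | zero => simp
  | succ n ih =>
    intro q
    have h : eulerOp R ((X - 1) ^ (n + 1) * q) =
        (X - 1) ^ n * (((n + 1 : ℕ) : R[X]) * X * q + (X - 1) * X * derivative q) := by
      rw [eulerOp_apply]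
      simp only [derivative_mul, derivative_pow, derivative_sub, derivative_X, derivative_one,
        Nat.add_sub_cancel, sub_zero, mul_one]
      simp only [map_natCast]
      ring
    rw [pow_succ, Module.End.mul_apply, h, ih]
    simp [Nat.factorial_succ]
    ring

end EulerOp

lemma factorial_half_sq (p m : ℕ) [Fact p.Prime] (hm : p = 2 * m + 1) (he : Even m) :
    ((m.factorial : ZMod p)) ^ 2 = -1 := by
  have h := ZMod.wilsons_lemma p
  rw [show p - 1 = m + m by omega, ← Nat.factorial_mul_ascFactorial] at h
  rw [Nat.ascFactorial_eq_prod_range, ← Finset.prod_range_reflect] at h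
  have h2 : ((∏ j ∈ Finset.range m, (m + 1 + (m - 1 - j)) : ℕ) : ZMod p) = m.factorial := by
    rw [Nat.cast_prod, ← Finset.prod_range_add_one_eq_factorial, Nat.cast_prod]
    have : ∀ j ∈ Finset.range m, ((m + 1 + (m - 1 - j) : ℕ) : ZMod p) =
        - ((j + 1 : ℕ) : ZMod p) := by
      intro j hj
      rw [Finset.mem_range] at hj
      rw [eq_neg_iff_add_eq_zero, ← Nat.cast_add]
      rw [show m + 1 + (m - 1 - j) + (j + 1) = p by omega]
      simp
    rw [Finset.prod_congr rfl this, Finset.prod_neg]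
    simp [he.neg_one_pow]
  rw [Nat.cast_mul, h2] at h
  rw [sq, h]

lemma quadraticGaussSum_sign (p m : ℕ) [Fact p.Prime] (hm : p = 2 * m + 1)
    (he : Even m) (hm0 : 0 < m)
    (ζ : ℂ) (hζ : IsPrimitiveRoot ζ p) (ε : ℤ) (hε : ε = 1 ∨ ε = -1)
    (h : ∑ j ∈ Finset.range p, (legendreSym p j : ℂ) * ζ ^ j =
      ε * ∏ k ∈ Finset.range m, (ζ ^ ((k + 1) * (m + 1)) - ζ ^ ((k + 1) * (m + 1) * (p - 1)))) :
    ε = 1 := by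
  classical
  have hp : p.Prime := Fact.out
  let f : Polynomial ℤ := ∑ j ∈ Finset.range p, Polynomial.C (legendreSym p j) * Polynomial.X ^ j -
    Polynomial.C ε * ∏ k ∈ Finset.range m, (Polynomial.X ^ ((k + 1) * (m + 1)) -
      Polynomial.X ^ ((k + 1) * (m + 1) * (p - 1)))
  have hdvd : Polynomial.cyclotomic p ℤ ∣ f := by
    rw [Polynomial.cyclotomic_eq_minpoly hζ hp.pos]
    refine minpoly.isIntegrallyClosed_dvd (hζ.isIntegral hp.pos) ?_
    simp only [f, map_sub, map_sum, map_mul, map_prod, map_pow, Polynomial.aeval_X,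
      eq_intCast, map_intCast]
    rw [h, sub_self]
  have hcyc : Polynomial.cyclotomic p (ZMod p) = (Polynomial.X - 1) ^ (p - 1) := by
    have := Polynomial.cyclotomic_mul_prime_eq_pow_of_not_dvd (ZMod p) (p := p) (n := 1)
      (by simpa using hp.one_lt.ne')
    simpa using this
  obtain ⟨H, hH⟩ := Polynomial.map_dvd (Int.castRingHom (ZMod p)) hdvd
  rw [Polynomial.map_cyclotomic, hcyc] at hH
  have h1 : ((eulerOp (ZMod p) ^ m) (f.map (Int.castRingHom (ZMod p)))).eval 1 = 0 := by
    rw [hH, show p - 1 = m + m by omega, pow_add, mul_assoc, eval_one_eulerOp_pow]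
    simp [hm0.ne']
  have h2 : ((eulerOp (ZMod p) ^ m) (∑ j ∈ Finset.range p,
      Polynomial.C ((legendreSym p j : ZMod p)) * Polynomial.X ^ j)).eval 1 = -1 := by
    simp only [← Polynomial.smul_eq_C_mul, map_sum, map_smul, eulerOp_pow_X_pow,
      Polynomial.eval_finsetSum, Polynomial.eval_smul, Polynomial.eval_pow, Polynomial.eval_X,
      legendreSym.eq_pow, smul_eq_mul, one_pow, mul_one]
    rw [Finset.sum_congr rfl (g := fun j => if j = 0 then (0 : ZMod p) else 1)]
    · rw [Finset.sum_ite]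
      have : (Finset.range p).filter (fun x => ¬ x = 0) = (Finset.range p).erase 0 := by
        ext; simp [and_comm]
      simp [this, hp.pos, hp.one_le]
    · intro j hj
      rw [Finset.mem_range] at hj
      split_ifs with h0
      · simp [h0, hm0.ne']
      · have hj0 : (j : ZMod p) ≠ 0 := by
          rw [Ne, ZMod.natCast_eq_zero_iff]
          exact Nat.not_dvd_of_pos_of_lt (Nat.pos_of_ne_zero h0) hj
        rw [show p / 2 = m by omega, Int.cast_natCast, ← pow_add, show m + m = p - 1 by omega]
        exact ZMod.pow_card_sub_one_eq_one hj0
  have h3 : ((eulerOp (ZMod p) ^ m) (∏ k ∈ Finset.range m, (Polynomial.X ^ ((k + 1) * (m + 1)) -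
      Polynomial.X ^ ((k + 1) * (m + 1) * (p - 1))))).eval 1 = -1 := by
    have hfac : ∀ k : ℕ, ((Polynomial.X : Polynomial (ZMod p)) ^ ((k + 1) * (m + 1)) -
        Polynomial.X ^ ((k + 1) * (m + 1) * (p - 1))) = (Polynomial.X - 1) *
        (∑ i ∈ Finset.range ((k + 1) * (m + 1)), Polynomial.X ^ i -
          ∑ i ∈ Finset.range ((k + 1) * (m + 1) * (p - 1)), Polynomial.X ^ i) := by
      intro k
      rw [mul_sub, mul_geom_sum, mul_geom_sum]
      ring
    simp only [hfac]
    rw [Finset.prod_mul_distrib, Finset.prod_const, Finset.card_range, eval_one_eulerOp_pow,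
      Polynomial.eval_prod]
    have : ∀ k ∈ Finset.range m, Polynomial.eval 1 (∑ i ∈ Finset.range ((k + 1) * (m + 1)),
        Polynomial.X ^ i -
          ∑ i ∈ Finset.range ((k + 1) * (m + 1) * (p - 1)), Polynomial.X ^ i) =
              ((k + 1 : ℕ) : ZMod p) := by
      intro k _
      simp only [Polynomial.eval_sub, Polynomial.eval_finsetSum, Polynomial.eval_pow,
        Polynomial.eval_X, one_pow, Finset.sum_const, Finset.card_range, nsmul_eq_mul, mul_one]
      rw [Nat.cast_mul _ (p - 1), Nat.cast_sub hp.one_le]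
      have h0 : (2 : ZMod p) * m + 1 = 0 := by
        have := congrArg (Nat.cast : ℕ → ZMod p) hm
        rw [ZMod.natCast_self] at this
        rw [this]
        push_cast; ring
      push_cast
      rw [ZMod.natCast_self]
      linear_combination ((k : ZMod p) + 1) * h0
    rw [Finset.prod_congr rfl this, ← Nat.cast_prod, Finset.prod_range_add_one_eq_factorial, ← sq]
    exact factorial_half_sq p m hm he
  have h4 : f.map (Int.castRingHom (ZMod p)) = ∑ j ∈ Finset.range p,
      Polynomial.C ((legendreSym p j : ZMod p)) * Polynomial.X ^ j - (ε : ZMod p) •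
      ∏ k ∈ Finset.range m, (Polynomial.X ^ ((k + 1) * (m + 1)) -
      Polynomial.X ^ ((k + 1) * (m + 1) * (p - 1))) := by
    simp [f, Polynomial.map_sum, Polynomial.map_prod, Polynomial.smul_eq_C_mul]
  rw [h4, map_sub, Polynomial.eval_sub, h2, map_smul, Polynomial.eval_smul, h3] at h1
  rcases hε with hε | hε
  · exact hε
  · exfalso
    subst hε
    have h5 : ((2 : ℕ) : ZMod p) = 0 := by
      push_cast
      simp only [Int.cast_neg, Int.cast_one, smul_eq_mul] at h1
      linear_combination -h1
    rw [ZMod.natCast_eq_zero_iff] at h5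
    have := Nat.le_of_dvd (by norm_num) h5
    omega

lemma sinProd_sq (p m : ℕ) (hm : p = 2 * m + 1) (he : Even m)
    (ζ : ℂ) (hζ : IsPrimitiveRoot ζ p) :
    (∏ k ∈ Finset.range m, (ζ ^ ((k + 1) * (m + 1)) - ζ ^ ((k + 1) * (m + 1) * (p - 1)))) ^ 2 =
        p := by
  have hz : ζ ^ p = 1 := hζ.pow_eq_one
  have h := IsPrimitiveRoot.prod_one_sub_pow_eq_order (n := m + m) (μ := ζ)
    (by convert hζ using 1; omega)
  rw [Finset.prod_range_add, ← Finset.prod_range_reflect (fun x => 1 - ζ ^ (m + x + 1))] at h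
  rw [← Finset.prod_mul_distrib] at h
  have h2 : ∀ k ∈ Finset.range m, (ζ ^ ((k + 1) * (m + 1)) - ζ ^ ((k + 1) * (m + 1) * (p - 1))) ^ 2
      = - ((1 - ζ ^ (k + 1)) * (1 - ζ ^ (m + (m - 1 - k) + 1))) := by
    intro k hk
    rw [Finset.mem_range] at hk
    have e1 : (ζ ^ ((k + 1) * (m + 1))) ^ 2 = ζ ^ (k + 1) := by
      rw [← pow_mul, show (k + 1) * (m + 1) * 2 = p * (k + 1) + (k + 1) by subst hm; ring, pow_add,
        pow_mul, hz]
      simp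
    have e2 : ζ ^ ((k + 1) * (m + 1)) * ζ ^ ((k + 1) * (m + 1) * (p - 1)) = 1 := by
      rw [← pow_add, show (k + 1) * (m + 1) + (k + 1) * (m + 1) * (p - 1) =
        p * ((k + 1) * (m + 1)) by subst hm; simp only [Nat.add_sub_cancel]; ring, pow_mul, hz,
            one_pow]
    have e3 : ζ ^ (k + 1) * ζ ^ (m + (m - 1 - k) + 1) = 1 := by
      rw [← pow_add, show (k + 1) + (m + (m - 1 - k) + 1) = p by omega, hz]
    have e4 : (ζ ^ ((k + 1) * (m + 1) * (p - 1))) ^ 2 = ζ ^ (m + (m - 1 - k) + 1) := by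
      have hne : ζ ^ (k + 1) ≠ 0 := left_ne_zero_of_mul_eq_one e3
      apply mul_left_cancel₀ hne
      rw [e3, ← e1, ← mul_pow, e2, one_pow]
    linear_combination e1 + e4 - 2 * e2 + e3
  rw [← Finset.prod_pow, Finset.prod_congr rfl h2, Finset.prod_neg, h]
  subst hm
  simp [he.neg_one_pow]
  ring

lemma sinProd_pos (p m : ℕ) (hm : p = 2 * m + 1) (he : Even m) :
    ∃ P : ℝ, 0 < P ∧ ∏ k ∈ Finset.range m,
      (Complex.exp (2 * Real.pi * Complex.I / p) ^ ((k + 1) * (m + 1)) -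
        Complex.exp (2 * Real.pi * Complex.I / p) ^ ((k + 1) * (m + 1) * (p - 1))) = P := by
  have hp0 : (p : ℂ) ≠ 0 := by simp [hm]; exact_mod_cast (by omega : 2 * m + 1 ≠ 0)
  have key : ∀ k : ℕ, (Complex.exp (2 * Real.pi * Complex.I / p) ^ ((k + 1) * (m + 1)) -
        Complex.exp (2 * Real.pi * Complex.I / p) ^ ((k + 1) * (m + 1) * (p - 1))) =
      (Complex.I * (-1) ^ (k + 1)) * ((2 * Real.sin (Real.pi * (k + 1) / p) : ℝ) : ℂ) := by
    intro k
    set w : ℂ := Complex.exp (Real.pi * (k + 1) / p * Complex.I) with hw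
    have e1 : Complex.exp (2 * Real.pi * Complex.I / p) ^ ((k + 1) * (m + 1)) =
        (-1) ^ (k + 1) * w := by
      rw [← Complex.exp_nat_mul, ← Complex.exp_pi_mul_I, ← Complex.exp_nat_mul, hw,
          ← Complex.exp_add]
      congr 1
      have : (p : ℂ) = 2 * m + 1 := by rw [hm]; push_cast; ring
      field_simp
      rw [this]
      push_cast
      ring
    have e2 : Complex.exp (2 * Real.pi * Complex.I / p) ^ ((k + 1) * (m + 1) * (p - 1)) =
        (-1) ^ (k + 1) * w⁻¹ := by
      have hpp : Complex.exp (2 * Real.pi * Complex.I / p) ^ p = 1 := by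
        rw [← Complex.exp_nat_mul, mul_div_cancel₀ _ hp0, Complex.exp_two_pi_mul_I]
      have : ((-1) ^ (k + 1) * w) * Complex.exp (2 * Real.pi * Complex.I / p) ^ ((k + 1) *
          (m + 1) * (p - 1)) = 1 := by
        rw [← e1, ← pow_add, show (k + 1) * (m + 1) + (k + 1) * (m + 1) * (p - 1) =
        p * ((k + 1) * (m + 1)) by subst hm; simp only [Nat.add_sub_cancel]; ring, pow_mul, hpp,
            one_pow]
      have hw0 : w ≠ 0 := Complex.exp_ne_zero _
      have hs : ((-1 : ℂ) ^ (k + 1)) * (-1) ^ (k + 1) = 1 := by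
        rw [← mul_pow]; simp
      apply mul_left_cancel₀ (left_ne_zero_of_mul_eq_one this)
      rw [this, mul_mul_mul_comm, hs, mul_inv_cancel₀ hw0, one_mul]
    rw [e1, e2, hw, ← Complex.exp_neg]
    push_cast
    rw [Complex.sin]
    rw [show -(↑Real.pi * ((k : ℂ) + 1) / ↑p * Complex.I) = -(↑Real.pi * (↑k + 1) / ↑p) *
        Complex.I by ring]
    ring_nf
    simp only [Complex.I_sq]
    ring
  have hI : ∀ n : ℕ, ∏ k ∈ Finset.range (n + n), (Complex.I * (-1) ^ (k + 1)) = 1 := by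
    intro n
    induction n with
    | zero => simp
    | succ n ih =>
      rw [show n + 1 + (n + 1) = n + n + 1 + 1 by ring, Finset.prod_range_succ,
        Finset.prod_range_succ, ih]
      have : Even (n + n) := ⟨n, rfl⟩
      have e : ((-1 : ℂ)) ^ (n + n) = 1 := this.neg_one_pow
      simp only [pow_succ, e]
      ring_nf
      simp
  obtain ⟨n, rfl⟩ := he
  refine ⟨∏ k ∈ Finset.range (n + n), 2 * Real.sin (Real.pi * (k + 1) / p), ?_, ?_⟩
  · refine Finset.prod_pos fun k hk => mul_pos two_pos (Real.sin_pos_of_pos_of_lt_pi ?_ ?_)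
    · have : (0 : ℝ) < p := by rw [hm]; exact_mod_cast (by omega)
      positivity
    · have : (0 : ℝ) < p := by rw [hm]; exact_mod_cast (by omega)
      rw [div_lt_iff₀ this]
      rw [Finset.mem_range] at hk
      have : ((k : ℝ) + 1) < p := by rw [hm]; exact_mod_cast (by omega)
      exact mul_lt_mul_of_pos_left this Real.pi_pos
  · rw [Finset.prod_congr rfl (fun k _ => key k), Finset.prod_mul_distrib, hI, one_mul]
    push_cast
    rfl

lemma sum_zmod_eq_sum_range {M : Type*} [AddCommMonoid M] (p : ℕ) [NeZero p] (F : ZMod p → M) :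
    ∑ a : ZMod p, F a = ∑ j ∈ Finset.range p, F j := by
  refine Finset.sum_nbij' (fun a => a.val) (fun j => (j : ZMod p)) ?_ ?_ ?_ ?_ ?_
  · intro a _; simpa using ZMod.val_lt a
  · intro j _; simp
  · intro a _; simp
  · intro j hj; exact ZMod.val_cast_of_lt (Finset.mem_range.1 hj)
  · intro a _; simp

lemma stdAddChar_natCast (p : ℕ) [NeZero p] (j : ℕ) :
    ZMod.stdAddChar (j : ZMod p) = Complex.exp (2 * Real.pi * Complex.I / p) ^ j := by
  have := ZMod.stdAddChar_coe (N := p) (j : ℤ)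
  rw [Int.cast_natCast] at this
  rw [this, ← Complex.exp_nat_mul]
  congr 1
  push_cast
  ring

lemma sum_legendreSym_mul_exp (p : ℕ) [Fact p.Prime] (hp4 : p % 4 = 1) :
    ∑ j ∈ Finset.range p, (legendreSym p j : ℂ) * Complex.exp (2 * Real.pi * Complex.I / p) ^ j
      = (Real.sqrt p : ℂ) := by
  have hp : p.Prime := Fact.out
  have hp2 := hp.two_le
  have hm : p = 2 * (p / 2) + 1 := by omega
  have he : Even (p / 2) := by rw [Nat.even_iff]; omega
  have hζ : IsPrimitiveRoot (Complex.exp (2 * Real.pi * Complex.I / p)) p :=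
    Complex.isPrimitiveRoot_exp p hp.ne_zero
  have hchar : ringChar (ZMod p) ≠ 2 := by rw [ZMod.ringChar_zmod_n]; omega
  have hsq : (∑ j ∈ Finset.range p, (legendreSym p j : ℂ) *
      Complex.exp (2 * Real.pi * Complex.I / p) ^ j) ^ 2 = p := by
    let χ : MulChar (ZMod p) ℂ := (quadraticChar (ZMod p)).ringHomComp (Int.castRingHom ℂ)
    have hq : χ.IsQuadratic := (quadraticChar_isQuadratic (ZMod p)).comp _
    have h1 : χ ≠ 1 := by
      rw [MulChar.ne_one_iff]
      obtain ⟨a, ha⟩ := quadraticChar_exists_neg_one' hchar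
      exact ⟨a, by simp [χ, ha]; norm_num⟩
    have := gaussSum_sq h1 hq (ZMod.isPrimitive_stdAddChar p)
    rw [gaussSum, sum_zmod_eq_sum_range, ZMod.card] at this
    have h2 : χ (-1) = 1 := by
      have := quadraticChar_neg_one hchar
      rw [ZMod.card, ZMod.χ₄_nat_one_mod_four hp4] at this
      simp [χ, this]
    rw [h2, one_mul] at this
    refine Eq.trans ?_ this
    congr 1
    refine Finset.sum_congr rfl fun j _ => ?_
    rw [stdAddChar_natCast]
    simp [χ, legendreSym]
  obtain ⟨P, hP, hprod⟩ := sinProd_pos p (p / 2) hm he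
  have hPsq := sinProd_sq p (p / 2) hm he _ hζ
  have hPs : P = Real.sqrt p := by
    rw [hprod] at hPsq
    have : P ^ 2 = p := by exact_mod_cast hPsq
    rw [← this, Real.sqrt_sq hP.le]
  have hcase := sq_eq_sq_iff_eq_or_eq_neg.1 (hsq.trans hPsq.symm)
  rw [← hPs, ← hprod]
  rcases hcase with h | h
  · exact h
  · have := quadraticGaussSum_sign p (p / 2) hm he (by omega) _ hζ (-1) (Or.inr rfl)
      (by rw [h]; push_cast; ring)
    norm_num at this

lemma sum_legendreSym_mul_exp_pow (p : ℕ) [Fact p.Prime] (hp4 : p % 4 = 1) (n : ℕ) :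
    ∑ a ∈ Finset.range p, (legendreSym p a : ℂ) *
      (Complex.exp (2 * Real.pi * Complex.I / p) ^ a) ^ n =
          legendreSym p n * (Real.sqrt p : ℂ) := by
  have hp : p.Prime := Fact.out
  have hp2 := hp.two_le
  have hchar : ringChar (ZMod p) ≠ 2 := by rw [ZMod.ringChar_zmod_n]; omega
  have h0 : ∑ a ∈ Finset.range p, (legendreSym p a : ℂ) *
      (Complex.exp (2 * Real.pi * Complex.I / p) ^ a) ^ n =
      ∑ a : ZMod p, (quadraticChar (ZMod p) a : ℂ) * ZMod.stdAddChar (a * (n : ZMod p)) := by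
    rw [sum_zmod_eq_sum_range]
    refine Finset.sum_congr rfl fun j _ => ?_
    rw [← Nat.cast_mul, stdAddChar_natCast, pow_mul]
    simp [legendreSym]
  have h1 : (Real.sqrt p : ℂ) = ∑ a : ZMod p, (quadraticChar (ZMod p) a : ℂ) *
      ZMod.stdAddChar a := by
    rw [sum_zmod_eq_sum_range, ← sum_legendreSym_mul_exp p hp4]
    refine Finset.sum_congr rfl fun j _ => ?_
    rw [stdAddChar_natCast]
    simp [legendreSym]
  rw [h0, h1]
  by_cases hn : (n : ZMod p) = 0
  · have : legendreSym p n = 0 := (legendreSym.eq_zero_iff p n).2 (by simpa using hn)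
    rw [this, hn]
    simp only [mul_zero, AddChar.map_zero_eq_one, mul_one, Int.cast_zero, zero_mul]
    exact_mod_cast quadraticChar_sum_zero hchar
  · have hl : legendreSym p n = quadraticChar (ZMod p) (n : ZMod p) := by simp [legendreSym]
    rw [hl, Finset.mul_sum]
    refine Fintype.sum_equiv (Equiv.mulRight₀ (n : ZMod p) hn) _ _ fun a => ?_
    simp only [Equiv.mulRight₀_apply, map_mul]
    have : (quadraticChar (ZMod p) (n : ZMod p)) * (quadraticChar (ZMod p) (n : ZMod p)) = 1 := by
      rw [← sq, quadraticChar_sq_one hn]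
    have h2 : ((quadraticChar (ZMod p) (n : ZMod p) : ℤ) : ℂ) *
        (quadraticChar (ZMod p) (n : ZMod p) : ℤ) = 1 := by
      exact_mod_cast this
    push_cast
    linear_combination (-((quadraticChar (ZMod p) a : ℤ) : ℂ) *
        ZMod.stdAddChar (a * (n : ZMod p))) * h2

lemma arctan_arg_exp {θ : ℝ} (h : Real.cos θ ≠ 0) :
    1 - Complex.exp (θ * Complex.I) * Complex.I ≠ 0 ∧
    (1 + Complex.exp (θ * Complex.I) * Complex.I) / (1 - Complex.exp (θ * Complex.I) * Complex.I) =
      ((Real.cos θ / (1 + Real.sin θ) : ℝ) : ℂ) * Complex.I := by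
  have hs : 1 + Real.sin θ ≠ 0 := by
    intro h0
    apply h
    have := Real.sin_sq_add_cos_sq θ
    have h1 : Real.sin θ = -1 := by linarith
    rw [h1] at this
    nlinarith
  have hz : Complex.exp (θ * Complex.I) = Real.cos θ + Real.sin θ * Complex.I := by
    rw [Complex.exp_mul_I]; simp
  have hne : 1 - Complex.exp (θ * Complex.I) * Complex.I ≠ 0 := by
    intro h0
    have := congrArg Complex.re h0
    rw [hz] at this
    simp at this
    exact hs (by simpa [Complex.cos_ofReal_re, Complex.sin_ofReal_re] using this)
  refine ⟨hne, ?_⟩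
  rw [div_eq_iff hne, hz]
  have hs' : ((1 + Real.sin θ : ℝ) : ℂ) ≠ 0 := by exact_mod_cast hs
  have hsc : ((Real.cos θ : ℝ) : ℂ) ^ 2 + ((Real.sin θ : ℝ) : ℂ) ^ 2 = 1 := by
    exact_mod_cast Real.cos_sq_add_sin_sq θ
  rw [Complex.ofReal_div]
  generalize hc : ((Real.cos θ : ℝ) : ℂ) = c at *
  push_cast at *
  rw [← Complex.ofReal_sin] at *
  generalize ((Real.sin θ : ℝ) : ℂ) = s at *
  rw [div_mul_eq_mul_div, div_mul_eq_mul_div, eq_div_iff hs']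
  have hI := Complex.I_sq
  linear_combination (s + s ^ 2 + c ^ 2 + c * s * Complex.I) * hI - hsc

lemma arctan_exp_aux {θ : ℝ} (h : Real.cos θ ≠ 0) :
    ContinuousAt Complex.arctan (Complex.exp (θ * Complex.I)) ∧
    (Complex.arctan (Complex.exp (θ * Complex.I))).re =
      SignType.sign (Real.cos θ) * (Real.pi / 4) := by
  obtain ⟨hne, heq⟩ := arctan_arg_exp h
  have hs : 0 < 1 + Real.sin θ := by
    have h1 := Real.neg_one_le_sin θ
    rcases eq_or_lt_of_le h1 with h2 | h2
    · exfalso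
      apply h
      have := Real.sin_sq_add_cos_sq θ
      rw [← h2] at this
      nlinarith
    · linarith
  have hy : Real.cos θ / (1 + Real.sin θ) ≠ 0 := div_ne_zero h hs.ne'
  constructor
  · unfold Complex.arctan
    refine ContinuousAt.mul continuousAt_const (ContinuousAt.clog ?_ ?_)
    · exact ContinuousAt.div (by fun_prop) (by fun_prop) hne
    · rw [heq, Complex.mem_slitPlane_iff]
      right
      rw [Complex.im_ofReal_mul]
      simpa only [Complex.I_im, mul_one] using hy
  · unfold Complex.arctan
    rw [heq]
    have h3 : (-Complex.I / 2 * Complex.log (((Real.cos θ / (1 + Real.sin θ) : ℝ) : ℂ) *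
        Complex.I)).re =
      Complex.arg (((Real.cos θ / (1 + Real.sin θ) : ℝ) : ℂ) * Complex.I) / 2 := by
      rw [← Complex.log_im]
      generalize Complex.log _ = w
      rw [show -Complex.I / 2 * w = ((-1 / 2 : ℝ) : ℂ) * (Complex.I * w) by push_cast; ring,
        Complex.re_ofReal_mul]
      simp
      ring
    rw [h3]
    rcases lt_or_gt_of_ne h with hc | hc
    · have : Real.cos θ / (1 + Real.sin θ) < 0 := div_neg_of_neg_of_pos hc hs
      rw [show ((Real.cos θ / (1 + Real.sin θ) : ℝ) : ℂ) * Complex.I =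
        ((-(Real.cos θ / (1 + Real.sin θ)) : ℝ) : ℂ) * (-Complex.I) by push_cast; ring,
        Complex.arg_real_mul _ (by linarith), Complex.arg_neg_I, sign_neg hc]
      simp; ring
    · have : 0 < Real.cos θ / (1 + Real.sin θ) := div_pos hc hs
      rw [Complex.arg_real_mul _ this, Complex.arg_I, sign_pos hc]
      simp; ring

lemma hasSum_chi_four_arctan {z : ℂ} (hz : ‖z‖ < 1) :
    HasSum (fun n : ℕ => (ZMod.χ₄ n : ℂ) * z ^ n / n) (Complex.arctan z) := by
  have hinj : Function.Injective (fun n : ℕ => 2 * n + 1) := fun a b h => by simpa using h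
  rw [← hinj.hasSum_iff]
  · convert Complex.hasSum_arctan hz using 2 with n
    simp only [Function.comp]
    rw [ZMod.χ₄_eq_neg_one_pow (by omega), show (2 * n + 1) / 2 = n by omega]
    push_cast; ring
  · intro n hn
    have : ZMod.χ₄ n = 0 := by
      rw [ZMod.χ₄_nat_eq_if_mod_four, if_pos]
      by_contra h
      exact hn ⟨n / 2, by simp only; omega⟩
    simp [this]

open Filter Topology in
lemma limit_mul_sqrt (p : ℕ) [Fact p.Prime]
    (hG : ∀ n : ℕ, ∑ a ∈ Finset.range p, (legendreSym p a : ℂ) *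
      (Complex.exp (2 * Real.pi * Complex.I / p) ^ a) ^ n = legendreSym p n * (Real.sqrt p : ℂ))
          (l : ℝ)
    (hcos : ∀ a : ℕ, Real.cos (2 * Real.pi * a / p) ≠ 0)
    (hl : Tendsto (fun n : ℕ => ∑ k ∈ Finset.range n, ((ZMod.χ₄ k * legendreSym p k : ℤ) : ℝ) / k)
      atTop (𝓝 l)) :
    l * Real.sqrt p = ∑ a ∈ Finset.range p,
      (legendreSym p a : ℝ) * (SignType.sign (Real.cos (2 * Real.pi * a / p)) * (Real.pi / 4)) := by
  have habel := Real.tendsto_tsum_powerSeries_nhdsWithin_lt hl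
  have hexp : ∀ a : ℕ, Complex.exp (2 * Real.pi * Complex.I / p) ^ a =
      Complex.exp ((2 * Real.pi * a / p : ℝ) * Complex.I) := by
    intro a
    rw [← Complex.exp_nat_mul]
    congr 1
    push_cast
    ring
  have hL : Tendsto (fun r : ℝ => ∑ a ∈ Finset.range p, (legendreSym p a : ℝ) *
      (Complex.arctan (r * Complex.exp ((2 * Real.pi * a / p : ℝ) * Complex.I))).re) (𝓝[<] 1)
      (𝓝 (∑ a ∈ Finset.range p,
      (legendreSym p a : ℝ) * (SignType.sign (Real.cos (2 * Real.pi * a / p)) *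
          (Real.pi / 4)))) := by
    refine tendsto_finsetSum _ fun a _ => Tendsto.const_mul _ ?_
    obtain ⟨hc, hr⟩ := arctan_exp_aux (hcos a)
    rw [← hr]
    refine (Complex.continuous_re.tendsto _).comp ?_
    refine Tendsto.comp (g := Complex.arctan) hc ?_
    have : Tendsto (fun r : ℝ => (r : ℂ) * Complex.exp ((2 * Real.pi * a / p : ℝ) *
        Complex.I)) (𝓝 1)
      (𝓝 (((1 : ℝ) : ℂ) * Complex.exp ((2 * Real.pi * a / p : ℝ) * Complex.I))) :=
      Continuous.tendsto (by fun_prop) 1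
    rw [Complex.ofReal_one, one_mul] at this
    exact this.mono_left nhdsWithin_le_nhds
  refine tendsto_nhds_unique (Tendsto.congr' ?_ (habel.mul_const (Real.sqrt p))) hL
  filter_upwards [Ioo_mem_nhdsLT (show (0 : ℝ) < 1 by norm_num)] with r hr
  have hn : ∀ a : ℕ, ‖(r : ℂ) * Complex.exp ((2 * Real.pi * a / p : ℝ) * Complex.I)‖ < 1 := by
    intro a
    rw [norm_mul, Complex.norm_exp_ofReal_mul_I, mul_one, Complex.norm_real,
        Real.norm_of_nonneg hr.1.le]
    exact hr.2
  have hsum := hasSum_sum (s := Finset.range p) fun a _ =>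
    (hasSum_chi_four_arctan (hn a)).mul_left (legendreSym p a : ℂ)
  have hterm : ∀ n : ℕ, ∑ a ∈ Finset.range p, (legendreSym p a : ℂ) * ((ZMod.χ₄ n : ℂ) *
      ((r : ℂ) * Complex.exp ((2 * Real.pi * a / p : ℝ) * Complex.I)) ^ n / n) =
      (((((ZMod.χ₄ n * legendreSym p n : ℤ) : ℝ) / n * r ^ n) * Real.sqrt p : ℝ) : ℂ) := by
    intro n
    have := hG n
    simp only [hexp] at this
    push_cast at this ⊢
    calc _ = ((ZMod.χ₄ n : ℤ) : ℂ) * r ^ n / n * ∑ a ∈ Finset.range p, (legendreSym p a : ℂ) *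
          Complex.exp (2 * Real.pi * a / p * Complex.I) ^ n := by
          rw [Finset.mul_sum]
          refine Finset.sum_congr rfl fun a _ => ?_
          rw [mul_pow]; ring
      _ = _ := by rw [this]; ring
  simp only [hterm] at hsum
  have hre := Complex.hasSum_re hsum
  simp only [Complex.ofReal_re] at hre
  rw [← tsum_mul_right, hre.tsum_eq]
  simp

lemma cos_two_pi_mul_div_ne_zero (p : ℕ) (hp4 : p % 4 = 1) (a : ℕ) :
    Real.cos (2 * Real.pi * a / p) ≠ 0 := by
  rw [Real.cos_ne_zero_iff]
  intro k h
  have hp0 : (p : ℝ) ≠ 0 := by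
    have : p ≠ 0 := by omega
    exact_mod_cast this
  have hpi := Real.pi_ne_zero
  field_simp at h
  have h2 : (4 * a : ℤ) = (2 * k + 1) * p := by
    have : (4 * a : ℝ) = (2 * k + 1) * p := by linarith
    exact_mod_cast this
  have h3 : (p : ℤ) = 2 * (p / 2 : ℕ) + 1 := by omega
  generalize ((p / 2 : ℕ) : ℤ) = m at h3
  rw [h3] at h2
  have : (2 * k + 1) * (2 * m + 1) = 2 * (2 * k * m + k + m) + 1 := by ring
  omega

lemma sign_cos_two_pi_mul_div (p : ℕ) (hp4 : p % 4 = 1) (a : ℕ) (ha : a < p) :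
    ((SignType.sign (Real.cos (2 * Real.pi * a / p)) : SignType) : ℝ) =
      1 - 2 * (if p < 4 * a ∧ 4 * a < 3 * p then 1 else 0) := by
  have hp : (0 : ℝ) < p := by
    have : 0 < p := by omega
    exact_mod_cast this
  have hpi := Real.pi_pos
  split_ifs with h
  · obtain ⟨h1, h2⟩ := h
    have h1' : (p : ℝ) < 4 * a := by exact_mod_cast h1
    have h2' : (4 * a : ℝ) < 3 * p := by exact_mod_cast h2
    rw [sign_neg (Real.cos_neg_of_pi_div_two_lt_of_lt ?_ ?_)]
    · simp; norm_num
    · rw [lt_div_iff₀ hp]; nlinarith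
    · rw [div_lt_iff₀ hp]; nlinarith
  · have hpos : 0 < Real.cos (2 * Real.pi * a / p) := by
      rcases not_and_or.1 h with h | h
      · have h1 : (4 * a : ℝ) < p := by
          have : 4 * a < p := by omega
          exact_mod_cast this
        apply Real.cos_pos_of_mem_Ioo
        constructor
        · have : 0 ≤ 2 * Real.pi * a / p := by positivity
          linarith
        · rw [div_lt_iff₀ hp]; nlinarith
      · have h1 : (3 * p : ℝ) < 4 * a := by
          have : 3 * p < 4 * a := by omega
          exact_mod_cast this
        have h2 : (a : ℝ) < p := by exact_mod_cast ha
        rw [← Real.cos_sub_two_pi]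
        apply Real.cos_pos_of_mem_Ioo
        constructor
        · have : 2 * Real.pi - Real.pi / 2 < 2 * Real.pi * a / p := by
            rw [lt_div_iff₀ hp]; nlinarith
          linarith
        · have : 2 * Real.pi * a / p < 2 * Real.pi := by
            rw [div_lt_iff₀ hp]; nlinarith
          linarith
    rw [sign_pos hpos]; simp

open scoped Classical in
lemma sum_legendreSym_second_quarter (p : ℕ) [Fact p.Prime] (hp4 : p % 4 = 1) :
    4 * ∑ a ∈ (Finset.range p).filter (fun a => p < 4 * a ∧ 2 * a < p), legendreSym p a =
      8 * (((Finset.range p).filter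
        (fun r => p < 4 * r ∧ 2 * r < p ∧ IsSquare (r : ZMod p))).card : ℤ) - (p - 1) := by
  have hcard : ((Finset.range p).filter (fun a => p < 4 * a ∧ 2 * a < p)).card = p / 4 := by
    have : (Finset.range p).filter (fun a => p < 4 * a ∧ 2 * a < p) =
        Finset.Ioc (p / 4) (2 * (p / 4)) := by
      ext a; simp only [Finset.mem_filter, Finset.mem_range, Finset.mem_Ioc]; omega
    rw [this, Nat.card_Ioc]; omega
  have hval : ∀ a ∈ (Finset.range p).filter (fun a => p < 4 * a ∧ 2 * a < p), legendreSym p a =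
      2 * (if IsSquare (a : ZMod p) then 1 else 0) - 1 := by
    intro a ha
    simp only [Finset.mem_filter, Finset.mem_range] at ha
    have ha0 : ((a : ℤ) : ZMod p) ≠ 0 := by
      rw [Int.cast_natCast, Ne, ZMod.natCast_eq_zero_iff]
      exact Nat.not_dvd_of_pos_of_lt (by omega) ha.1
    split_ifs with h
    · rw [(legendreSym.eq_one_iff p ha0).2 (by simpa using h)]; norm_num
    · rw [(legendreSym.eq_neg_one_iff p).2 (by simpa using h)]; norm_num
  rw [Finset.sum_congr rfl hval, Finset.sum_sub_distrib, ← Finset.mul_sum, Finset.sum_boole,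
    Finset.filter_filter, Finset.sum_const, hcard]
  have : ((p / 4 : ℕ) : ℤ) * 4 = p - 1 := by omega
  simp only [and_assoc, nsmul_eq_mul, mul_one]
  push_cast at *
  linarith

open scoped Classical in
lemma sum_legendreSym_mul_sign_cos (p : ℕ) [Fact p.Prime] (hp4 : p % 4 = 1) :
    ∑ a ∈ Finset.range p,
      (legendreSym p a : ℝ) * (SignType.sign (Real.cos (2 * Real.pi * a / p)) * (Real.pi / 4)) =
    (Real.pi / 4) * ((p - 1) - 8 * (((Finset.range p).filter
        (fun r => p < 4 * r ∧ 2 * r < p ∧ IsSquare (r : ZMod p))).card : ℝ)) := by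
  have h1 : ∀ a ∈ Finset.range p,
      (legendreSym p a : ℝ) * (SignType.sign (Real.cos (2 * Real.pi * a / p)) * (Real.pi / 4)) =
      Real.pi / 4 * ((legendreSym p a - 2 * (if p < 4 * a ∧ 4 * a < 3 * p then
        legendreSym p a else 0) : ℤ) : ℝ) := by
    intro a ha
    rw [sign_cos_two_pi_mul_div p hp4 a (Finset.mem_range.1 ha)]
    split_ifs
    · push_cast; ring
    · push_cast; ring
  rw [Finset.sum_congr rfl h1, ← Finset.mul_sum, ← Int.cast_sum]
  congr 1
  have h2 : ∑ a ∈ Finset.range p, legendreSym p a = 0 := by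
    have hchar : ringChar (ZMod p) ≠ 2 := by rw [ZMod.ringChar_zmod_n]; omega
    have := quadraticChar_sum_zero hchar
    rw [sum_zmod_eq_sum_range] at this
    rw [← this]
    exact Finset.sum_congr rfl fun j _ => by simp [legendreSym]
  have hneg : legendreSym p (-1) = 1 := by
    rw [legendreSym.at_neg_one (by omega), ZMod.χ₄_nat_one_mod_four hp4]
  have h3 : ∑ a ∈ (Finset.range p).filter (fun a => p < 4 * a ∧ 2 * a < p), legendreSym p a =
      ∑ a ∈ (Finset.range p).filter (fun a => p < 2 * a ∧ 4 * a < 3 * p), legendreSym p a := by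
    refine Finset.sum_nbij' (fun a => p - a) (fun a => p - a) ?_ ?_ ?_ ?_ ?_
    · intro a ha; simp only [Finset.mem_filter, Finset.mem_range] at *; omega
    · intro a ha; simp only [Finset.mem_filter, Finset.mem_range] at *; omega
    · intro a ha; simp only [Finset.mem_filter, Finset.mem_range] at *; omega
    · intro a ha; simp only [Finset.mem_filter, Finset.mem_range] at *; omega
    · intro a ha
      simp only [Finset.mem_filter, Finset.mem_range] at ha
      have : legendreSym p ((p - a : ℕ) : ℤ) = legendreSym p (-1 * a) := by
        rw [Nat.cast_sub ha.1.le]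
        simp [legendreSym]
      rw [this, legendreSym.mul, hneg, one_mul]
  have h4 : ∑ a ∈ (Finset.range p).filter (fun a => p < 4 * a ∧ 4 * a < 3 * p), legendreSym p a =
      2 * ∑ a ∈ (Finset.range p).filter (fun a => p < 4 * a ∧ 2 * a < p), legendreSym p a := by
    rw [two_mul]
    conv_rhs => rw [h3]
    conv_rhs => lhs; rw [← h3]
    rw [← Finset.sum_union]
    · congr 1
      ext a; simp only [Finset.mem_union, Finset.mem_filter, Finset.mem_range]; omega
    · rw [Finset.disjoint_left]
      intro a ha hb
      simp only [Finset.mem_filter, Finset.mem_range] at *; omega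
  have h5 := sum_legendreSym_second_quarter p hp4
  rw [Finset.sum_sub_distrib, ← Finset.mul_sum, ← Finset.sum_filter, h2, h4]
  have h6 : (0 - 2 * (2 * ∑ a ∈ (Finset.range p).filter (fun a => p < 4 * a ∧ 2 * a < p),
      legendreSym p a)) =
      (p - 1) - 8 * (((Finset.range p).filter
        (fun r => p < 4 * r ∧ 2 * r < p ∧ IsSquare (r : ZMod p))).card : ℤ) := by linarith
  rw [h6]
  push_cast
  ring

open Filter Topology MeasureTheory in
theorem tendsto_partialSum_and_LSeries_of_bounded (c : ℕ → ℤ) (hc0 : c 0 = 0)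
    (hc1 : ∀ n, |c n| ≤ 1) (C : ℝ)
    (hC : ∀ n, |∑ k ∈ Finset.Icc 1 n, (c k : ℝ)| ≤ C) :
    ∃ l : ℝ, Tendsto (fun n : ℕ => ∑ k ∈ Finset.range n, (c k : ℝ) / k) atTop (𝓝 l) ∧
      Tendsto (fun s : ℝ => LSeries (fun n => (c n : ℂ)) s) (𝓝[>] 1) (𝓝 (l : ℂ)) := by
  set T : ℝ → ℂ := fun t => ∑ k ∈ Finset.Icc 1 ⌊t⌋₊, (c k : ℂ) with hT
  have hTC : ∀ t, ‖T t‖ ≤ C := by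
    intro t
    have : T t = ((∑ k ∈ Finset.Icc 1 ⌊t⌋₊, (c k : ℝ) : ℝ) : ℂ) := by simp [hT]
    rw [this, Complex.norm_real]
    exact hC _
  have hIcc : ∀ n : ℕ, ∑ k ∈ Finset.Icc 0 n, (c k : ℂ) = ∑ k ∈ Finset.Icc 1 n, (c k : ℂ) := by
    intro n
    rw [← Finset.insert_Icc_add_one_left_eq_Icc n.zero_le, Finset.sum_insert (by simp), hc0]
    simp
  have hderiv : ∀ t ∈ Set.Ioi (1 : ℝ), deriv (fun x : ℝ => (x : ℂ) ^ (-1 : ℂ)) t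
      = -(t : ℂ) ^ (-2 : ℂ) := by
    intro t ht
    rw [Complex.deriv_ofReal_cpow_const (zero_lt_one.trans ht).ne' (by simp)]
    norm_num
  have hlim1 : Tendsto (fun n : ℕ => ∑ k ∈ Finset.range n, (c k : ℂ) / k) atTop
      (𝓝 (∫ t in Set.Ioi (1 : ℝ), T t * (t : ℂ) ^ (-2 : ℂ))) := by
    rw [← tendsto_add_atTop_iff_nat 1]
    simp_rw [Nat.range_succ_eq_Icc_zero]
    have key := tendsto_sum_mul_atTop_nhds_one_sub_integral₀ (c := fun n => (c n : ℂ))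
      (f := fun x : ℝ => (x : ℂ) ^ (-1 : ℂ)) (l := 0) (g := fun t => t ^ (-2 : ℝ))
      (by simp [hc0])
      (fun t ht => differentiableAt_id.ofReal_cpow_const (zero_lt_one.trans_le ht).ne' (by simp))
      ((Iff.mpr integrableOn_Ici_iff_integrableOn_Ioi <|
        integrableOn_Ioi_deriv_ofReal_cpow zero_lt_one (by simp)).locallyIntegrableOn)
      ?_ ?_ (integrableAtFilter_rpow_atTop_iff.mpr (by norm_num))
    · convert! key using 2
      · refine Finset.sum_congr rfl fun k _ => ?_
        rw [Complex.ofReal_natCast, Complex.cpow_neg_one, div_eq_inv_mul]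
      · rw [zero_sub, ← integral_neg]
        refine setIntegral_congr_fun measurableSet_Ioi fun t ht => ?_
        simp only [hderiv t ht, hIcc, hT]
        ring
    · rw [tendsto_zero_iff_norm_tendsto_zero]
      refine squeeze_zero (fun _ => norm_nonneg _) (g := fun n : ℕ => C / n) (fun n => ?_)
        (tendsto_const_div_atTop_nhds_zero_nat C)
      rw [norm_mul, Complex.ofReal_natCast, Complex.cpow_neg_one, norm_inv, Complex.norm_natCast,
        hIcc, div_eq_inv_mul]
      have := hTC n
      simp only [hT, Nat.floor_natCast] at this
      gcongr
    · refine Asymptotics.IsBigO.of_bound C ?_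
      filter_upwards [eventually_gt_atTop 1] with t ht
      rw [hderiv t ht, norm_mul, norm_neg, Complex.norm_cpow_eq_rpow_re_of_pos (by linarith), hIcc,
        mul_comm]
      have h0 : 0 ≤ t ^ (-2 : ℝ) := Real.rpow_nonneg (by linarith) _
      rw [Real.norm_of_nonneg h0]
      exact mul_le_mul_of_nonneg_right (hTC t) (by simpa using h0)
  have hsumm : ∀ s : ℝ, 1 < s → LSeriesSummable (fun n => (c n : ℂ)) s := by
    intro s hs
    refine LSeriesSummable_of_bounded_of_one_lt_re (m := 1) (fun n _ => ?_) (by simpa using hs)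
    rw [Complex.norm_intCast]
    exact_mod_cast hc1 n
  have hbigO : (fun n ↦ ∑ k ∈ Finset.Icc 1 n, (c k : ℂ)) =O[atTop]
      fun n : ℕ ↦ (n : ℝ) ^ (0 : ℝ) := by
    refine Asymptotics.IsBigO.of_bound C (Eventually.of_forall fun n => ?_)
    have := hTC n
    simp only [hT, Nat.floor_natCast] at this
    simpa using this
  have hmeasT : AEStronglyMeasurable T (volume.restrict (Set.Ioi 1)) := by
    have : Measurable T := by
      exact (measurable_from_nat (f := fun n => ∑ k ∈ Finset.Icc 1 n, (c k : ℂ))).comp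
        Nat.measurable_floor
    exact this.aestronglyMeasurable
  have hInt : Tendsto (fun s : ℝ => ∫ t in Set.Ioi (1 : ℝ), T t * (t : ℂ) ^ (-((s : ℂ) + 1)))
      (𝓝[>] 1) (𝓝 (∫ t in Set.Ioi (1 : ℝ), T t * (t : ℂ) ^ (-2 : ℂ))) := by
    refine tendsto_integral_filter_of_dominated_convergence (fun t => C * t ^ (-2 : ℝ)) ?_ ?_ ?_ ?_
    · refine Eventually.of_forall fun s => hmeasT.mul ?_
      refine ContinuousOn.aestronglyMeasurable (fun t ht => ?_) measurableSet_Ioi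
      exact (Complex.continuousAt_ofReal_cpow_const _ _
        (Or.inr (zero_lt_one.trans ht).ne')).continuousWithinAt
    · filter_upwards [self_mem_nhdsWithin] with s hs
      refine (ae_restrict_iff' measurableSet_Ioi).mpr (Eventually.of_forall fun t ht => ?_)
      have ht1 : (1 : ℝ) < t := ht
      have hs1 : (1 : ℝ) < s := hs
      rw [norm_mul, Complex.norm_cpow_eq_rpow_re_of_pos (by linarith)]
      have h0 : t ^ (-((s : ℂ) + 1)).re ≤ t ^ (-2 : ℝ) :=
        Real.rpow_le_rpow_of_exponent_le ht1.le (by simp; linarith)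
      exact mul_le_mul (hTC t) h0 (Real.rpow_nonneg (by linarith) _)
        ((norm_nonneg _).trans (hTC t))
    · exact (integrableOn_Ioi_rpow_of_lt (by norm_num) zero_lt_one).const_mul C
    · refine (ae_restrict_iff' measurableSet_Ioi).mpr (Eventually.of_forall fun t ht => ?_)
      have ht0 : (t : ℂ) ≠ 0 := by exact_mod_cast (zero_lt_one.trans ht).ne'
      have : ContinuousAt (fun s : ℝ => T t * (t : ℂ) ^ (-((s : ℂ) + 1))) 1 := by
        refine continuousAt_const.mul (ContinuousAt.const_cpow (by fun_prop) (Or.inl ht0))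
      have h := this.tendsto.mono_left (nhdsWithin_le_nhds (s := Set.Ioi 1))
      convert! h using 3
      norm_num
  have hlim2 : Tendsto (fun s : ℝ => LSeries (fun n => (c n : ℂ)) s) (𝓝[>] 1)
      (𝓝 (∫ t in Set.Ioi (1 : ℝ), T t * (t : ℂ) ^ (-2 : ℂ))) := by
    have h1 : Tendsto (fun s : ℝ => (s : ℂ)) (𝓝[>] 1) (𝓝 1) := by
      have : ContinuousAt (fun s : ℝ => (s : ℂ)) 1 := Complex.continuous_ofReal.continuousAt
      simpa using this.tendsto.mono_left (nhdsWithin_le_nhds (s := Set.Ioi 1))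
    have h2 := h1.mul hInt
    rw [one_mul] at h2
    refine h2.congr' ?_
    filter_upwards [self_mem_nhdsWithin] with s hs
    have hs1 : (1 : ℝ) < s := hs
    rw [LSeries_eq_mul_integral (fun n => (c n : ℂ)) le_rfl (s := (s : ℂ))
      (by simp; linarith) (hsumm s hs1) hbigO]
  generalize (∫ t in Set.Ioi (1 : ℝ), T t * (t : ℂ) ^ (-2 : ℂ)) = L at hlim1 hlim2
  have hre : Tendsto (fun n : ℕ => ∑ k ∈ Finset.range n, (c k : ℝ) / k) atTop (𝓝 L.re) := by
    refine ((Complex.continuous_re.tendsto L).comp hlim1).congr fun n => ?_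
    have : (∑ k ∈ Finset.range n, (c k : ℂ) / k) =
        ((∑ k ∈ Finset.range n, (c k : ℝ) / k : ℝ) : ℂ) := by push_cast; rfl
    simp only [Function.comp_apply, this, Complex.ofReal_re]
  have hL : (L.re : ℂ) = L := by
    refine tendsto_nhds_unique (((Complex.continuous_ofReal.tendsto _).comp hre).congr
      fun n => ?_) hlim1
    simp
  exact ⟨L.re, hre, by rwa [hL]⟩

theorem bounded_sum_range_of_antiperiodic (c : ℕ → ℤ) (m : ℕ) (hm : 0 < m)
    (hc : ∀ n, c (n + m) = -c n) :
    ∃ C : ℤ, ∀ n, |∑ k ∈ Finset.range n, c k| ≤ C := by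
  have hT : ∀ n, ∑ k ∈ Finset.range (n + m), c k + ∑ k ∈ Finset.range n, c k =
      ∑ k ∈ Finset.range m, c k := by
    intro n
    induction n with
    | zero => simp
    | succ n ih =>
      rw [Nat.add_right_comm, Finset.sum_range_succ, Finset.sum_range_succ, hc]
      linarith
  have hper : Function.Periodic (fun n => ∑ k ∈ Finset.range n, c k) (2 * m) := by
    intro n
    have h1 := hT n
    have h2 := hT (n + m)
    simp only [show n + 2 * m = n + m + m by ring]
    linarith
  refine ⟨∑ i ∈ Finset.range (2 * m), |∑ k ∈ Finset.range i, c k|, fun n => ?_⟩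
  rw [← hper.map_mod_nat n]
  exact Finset.single_le_sum (f := fun i => |∑ k ∈ Finset.range i, c k|)
    (fun _ _ => abs_nonneg _) (Finset.mem_range.mpr (Nat.mod_lt _ (by omega)))

theorem abs_chi_four_mul_legendreSym_le_one (p : ℕ) [Fact p.Prime] (n : ℕ) :
    |ZMod.χ₄ n * legendreSym p n| ≤ 1 := by
  have h1 : ∀ x : ZMod 4, |ZMod.χ₄ x| ≤ 1 := by decide
  have h2 : |legendreSym p n| ≤ 1 := by
    by_cases h : ((n : ℤ) : ZMod p) = 0
    · simp [(legendreSym.eq_zero_iff p n).mpr h]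
    · rcases legendreSym.eq_one_or_neg_one p h with h | h <;> simp [h]
  rw [abs_mul]
  exact mul_le_one₀ (h1 _) (abs_nonneg _) h2

open Filter Topology in
theorem exists_limit_chi_four_mul_legendreSym (p : ℕ) [Fact p.Prime] (hp4 : p % 4 = 1) :
    ∃ l : ℝ, Tendsto (fun n : ℕ => ∑ k ∈ Finset.range n,
        ((ZMod.χ₄ k * legendreSym p k : ℤ) : ℝ) / k) atTop (𝓝 l) ∧
      Tendsto (fun s : ℝ => LSeries (fun n => ((ZMod.χ₄ n * legendreSym p n : ℤ) : ℂ)) s)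
        (𝓝[>] 1) (𝓝 (l : ℂ)) := by
  have hanti : ∀ n : ℕ, ZMod.χ₄ (n + 2 * p : ℕ) * legendreSym p (n + 2 * p : ℕ) =
      -(ZMod.χ₄ n * legendreSym p n) := by
    intro n
    have h1 : legendreSym p (n + 2 * p : ℕ) = legendreSym p n := by
      rw [legendreSym.mod, legendreSym.mod p n]
      congr 1
      push_cast
      simp
    have h2 : ZMod.χ₄ (n + 2 * p : ℕ) = -ZMod.χ₄ n := by
      have : ((n + 2 * p : ℕ) : ZMod 4) = n + 2 := by
        have : ((p : ℕ) : ZMod 4) = 1 := by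
          rw [← ZMod.natCast_mod, hp4]; rfl
        push_cast
        rw [this]; ring
      rw [this]
      generalize (n : ZMod 4) = x
      revert x
      decide
    rw [h1, h2]; ring
  obtain ⟨C, hC⟩ := bounded_sum_range_of_antiperiodic
    (fun n => ZMod.χ₄ n * legendreSym p n) (2 * p)
    (by have := (Fact.out : p.Prime).pos; omega) hanti
  refine tendsto_partialSum_and_LSeries_of_bounded (fun n => ZMod.χ₄ n * legendreSym p n)
    (by simp) (abs_chi_four_mul_legendreSym_le_one p) C (fun n => ?_)
  · have h := hC (n + 1)
    rw [Nat.range_succ_eq_Icc_zero, ← Finset.insert_Icc_add_one_left_eq_Icc n.zero_le,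
      Finset.sum_insert (by simp)] at h
    have h0 : ZMod.χ₄ ((0 : ℕ) : ZMod 4) = 0 := rfl
    rw [h0, zero_mul, zero_add] at h
    exact_mod_cast h

theorem rat_eq_zero_of_sq_eq_neg {K : Type*} [Field K] [CharZero K] {p : ℕ} (hp : 0 < p) {α : K}
    (hα : α ^ 2 = -(p : K)) {u v : ℚ} (h : (u : K) + v * α = 0) : u = 0 ∧ v = 0 := by
  have h1 : (u : K) ^ 2 + p * v ^ 2 = 0 := by
    have : (u : K) = -(v * α) := eq_neg_of_add_eq_zero_left h
    rw [this, neg_sq, mul_pow, hα]; ring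
  have h2 : u ^ 2 + p * v ^ 2 = 0 := by exact_mod_cast h1
  have hp' : (0 : ℚ) < p := by exact_mod_cast hp
  have hv : v = 0 := by
    by_contra hv
    have : 0 < v ^ 2 := by positivity
    nlinarith [sq_nonneg u, mul_pos hp' this]
  subst hv
  refine ⟨?_, rfl⟩
  simpa using h2

theorem trace_add_mul_of_sq_eq {R S : Type*} [CommRing R] [CommRing S] [Algebra R S]
    (b : Module.Basis (Fin 2) R S) (h0 : b 0 = 1) (d : R) (h1 : b 1 ^ 2 = algebraMap R S d)
    (u v : R) : Algebra.trace R S (algebraMap R S u + algebraMap R S v * b 1) = 2 * u := by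
  have e0 : (algebraMap R S u + algebraMap R S v * b 1) * b 0 = u • b 0 + v • b 1 := by
    rw [h0, Algebra.smul_def, Algebra.smul_def]; ring
  have e1 : (algebraMap R S u + algebraMap R S v * b 1) * b 1 = (v * d) • b 0 + u • b 1 := by
    rw [h0, Algebra.smul_def, Algebra.smul_def, map_mul, ← h1]; ring
  rw [Algebra.trace_eq_matrix_trace b, Matrix.trace_fin_two, Algebra.leftMulMatrix_eq_repr_mul,
    Algebra.leftMulMatrix_eq_repr_mul, e0, e1]
  simp
  ring

theorem exists_rat_coords {K : Type*} [Field K] [NumberField K] {p : ℕ} (hp : 0 < p) {α : K}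
    (hα : α ^ 2 = -(p : K)) (hdeg : Module.finrank ℚ K = 2) (x : K) :
    ∃ u v : ℚ, x = u + v * α ∧ Algebra.trace ℚ K x = 2 * u := by
  have hli : LinearIndependent ℚ ![(1 : K), α] := by
    rw [LinearIndependent.pair_iff]
    intro s t hst
    refine rat_eq_zero_of_sq_eq_neg hp hα ?_
    simpa [Rat.smul_def] using hst
  let b := basisOfLinearIndependentOfCardEqFinrank hli (by simp [hdeg])
  have hb0 : b 0 = 1 := by simp [b]
  have hb1 : b 1 = α := by simp [b]
  have hx := b.sum_repr x
  rw [Fin.sum_univ_two, hb0, hb1] at hx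
  have hx' : x = (b.repr x 0 : K) + (b.repr x 1) * α := by
    conv_lhs => rw [← hx]
    simp only [Rat.smul_def, mul_one]
  refine ⟨b.repr x 0, b.repr x 1, hx', ?_⟩
  conv_lhs => rw [hx']
  have := trace_add_mul_of_sq_eq b hb0 (-(p : ℚ)) (by rw [hb1, hα]; simp) (b.repr x 0) (b.repr x 1)
  rw [hb1] at this
  simpa using this

theorem exists_int_of_isIntegral_ratCast {K : Type*} [Field K] [CharZero K] {u : ℚ}
    (h : IsIntegral ℤ (u : K)) : ∃ a : ℤ, (a : ℚ) = u := by
  have h' : IsIntegral ℤ u := by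
    have : IsIntegral ℤ (algebraMap ℚ K u) := by simpa using h
    exact (isIntegral_algebraMap_iff (algebraMap ℚ K).injective).mp this
  obtain ⟨a, ha⟩ := IsIntegrallyClosed.isIntegral_iff.mp h'
  exact ⟨a, by simpa using ha⟩

theorem exists_int_of_prime_mul_sq {p : ℕ} (hp : p.Prime) {w : ℚ} {k : ℤ} (h : p * w ^ 2 = k) :
    ∃ n : ℤ, (n : ℚ) = w := by
  have hInt : IsIntegral ℤ (p * w) := by
    refine IsIntegral.of_pow (n := 2) (by norm_num) ?_
    have : (p * w) ^ 2 = ((p * k : ℤ) : ℚ) := by push_cast; rw [← h]; ring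
    rw [this]
    exact isIntegral_algebraMap (R := ℤ) (x := (p * k : ℤ))
  obtain ⟨m, hm⟩ := exists_int_of_isIntegral_ratCast (K := ℚ) hInt
  have hm' : (m : ℚ) = p * w := hm
  have hp0 : (p : ℚ) ≠ 0 := by exact_mod_cast hp.ne_zero
  have hmk : m ^ 2 = p * k := by
    have : ((m ^ 2 : ℤ) : ℚ) = ((p * k : ℤ) : ℚ) := by
      push_cast
      rw [hm', ← h]; ring
    exact_mod_cast this
  obtain ⟨n, hn⟩ := (Nat.prime_iff_prime_int.mp hp).dvd_of_dvd_pow (Dvd.intro _ hmk.symm)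
  refine ⟨n, ?_⟩
  rw [hn] at hm'
  push_cast at hm'
  exact mul_left_cancel₀ hp0 hm'

theorem exists_int_coords {K : Type*} [Field K] [NumberField K] {p : ℕ} (hp : p.Prime)
    (hp4 : p % 4 = 1) {θ : 𝓞 K} (hθ : θ ^ 2 = -(p : 𝓞 K)) (hdeg : Module.finrank ℚ K = 2)
    (x : 𝓞 K) : ∃ a b : ℤ, x = a + b * θ := by
  have hα : (θ : K) ^ 2 = -(p : K) := by
    have := congrArg (algebraMap (𝓞 K) K) hθ
    simpa using this
  obtain ⟨u, v, hx, htr⟩ := exists_rat_coords hp.pos hα hdeg (x : K)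
  have hxi : IsIntegral ℤ (x : K) := x.2
  obtain ⟨m, hm⟩ : ∃ m : ℤ, (m : ℚ) = 2 * u := by
    refine exists_int_of_isIntegral_ratCast (K := ℚ) ?_
    have h := Algebra.isIntegral_trace (L := ℚ) hxi
    rw [htr] at h
    simpa using h
  have hmK : (m : K) = 2 * u := by exact_mod_cast congrArg (Rat.cast (K := K)) hm
  have hN : IsIntegral ℤ ((u ^ 2 + p * v ^ 2 : ℚ) : K) := by
    have : ((u ^ 2 + p * v ^ 2 : ℚ) : K) = algebraMap (𝓞 K) K (m * x - x ^ 2) := by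
      rw [map_sub, map_mul, map_pow, map_intCast, hmK, ← RingOfIntegers.coe_eq_algebraMap, hx]
      push_cast
      linear_combination (v : K) ^ 2 * hα
    rw [this]
    exact (m * x - x ^ 2 : 𝓞 K).2
  obtain ⟨N, hN⟩ := exists_int_of_isIntegral_ratCast hN
  obtain ⟨n, hn⟩ := exists_int_of_prime_mul_sq hp (w := 2 * v) (k := 4 * N - m ^ 2) (by
    push_cast
    rw [hN, hm]; ring)
  have hmn : m ^ 2 + p * n ^ 2 = 4 * N := by
    have : ((m ^ 2 + p * n ^ 2 : ℤ) : ℚ) = ((4 * N : ℤ) : ℚ) := by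
      push_cast
      rw [hm, hn, hN]; ring
    exact_mod_cast this
  obtain ⟨r, hr⟩ : ∃ r : ℤ, (p : ℤ) = 4 * r + 1 := ⟨p / 4, by omega⟩
  have h2 : (2 : ℤ) ∣ m ∧ (2 : ℤ) ∣ n := by
    have hmod : (m ^ 2 + n ^ 2) % 4 = 0 := by
      have : m ^ 2 + n ^ 2 = 4 * (N - r * n ^ 2) := by rw [hr] at hmn; linarith
      rw [this]; simp
    rcases Int.even_or_odd' m with ⟨i, rfl | rfl⟩ <;> rcases Int.even_or_odd' n with ⟨j, rfl | rfl⟩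
    · exact ⟨⟨i, rfl⟩, ⟨j, rfl⟩⟩
    all_goals ring_nf at hmod; omega
  obtain ⟨⟨a, rfl⟩, ⟨b, rfl⟩⟩ := h2
  refine ⟨a, b, ?_⟩
  have hu : u = a := by push_cast at hm; linarith
  have hv : v = b := by push_cast at hn; linarith
  apply RingOfIntegers.ext
  rw [hx, hu, hv]
  push_cast
  rfl

theorem int_coords_unique {K : Type*} [Field K] [NumberField K] {p : ℕ} (hp : 0 < p) {θ : 𝓞 K}
    (hθ : θ ^ 2 = -(p : 𝓞 K)) {a b : ℤ} (h : (a : 𝓞 K) + b * θ = 0) : a = 0 ∧ b = 0 := by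
  have hα : (θ : K) ^ 2 = -(p : K) := by
    have := congrArg (algebraMap (𝓞 K) K) hθ
    simpa using this
  have h' : ((a : ℚ) : K) + (b : ℚ) * (θ : K) = 0 := by
    have := congrArg (algebraMap (𝓞 K) K) h
    simpa using this
  have := rat_eq_zero_of_sq_eq_neg hp hα h'
  exact_mod_cast this

theorem exists_sq_eq_neg_ringOfIntegers {K : Type*} [Field K] [NumberField K] {p : ℕ} {α : K}
    (hα : α ^ 2 = -(p : K)) : ∃ θ : 𝓞 K, θ ^ 2 = -(p : 𝓞 K) := by
  have hInt : IsIntegral ℤ α := by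
    refine IsIntegral.of_pow (n := 2) (by norm_num) ?_
    rw [hα]
    exact IsIntegral.neg (isIntegral_natCast p)
  obtain ⟨θ, rfl⟩ : ∃ θ : 𝓞 K, algebraMap (𝓞 K) K θ = α := ⟨⟨α, hInt⟩, rfl⟩
  refine ⟨θ, RingOfIntegers.ext ?_⟩
  rw [RingOfIntegers.coe_eq_algebraMap, map_pow, hα, RingOfIntegers.coe_eq_algebraMap, map_neg,
    map_natCast]

theorem exists_ringOfIntegers_basis {K : Type*} [Field K] [NumberField K] {p : ℕ} (hp : p.Prime)
    (hp4 : p % 4 = 1) {θ : 𝓞 K} (hθ : θ ^ 2 = -(p : 𝓞 K)) (hdeg : Module.finrank ℚ K = 2) :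
    ∃ b : Module.Basis (Fin 2) ℤ (𝓞 K), b 0 = 1 ∧ b 1 = θ := by
  have hli : LinearIndependent ℤ ![(1 : 𝓞 K), θ] := by
    rw [LinearIndependent.pair_iff]
    intro s t hst
    refine int_coords_unique hp.pos hθ ?_
    simpa using hst
  refine ⟨Module.Basis.mk hli fun x _ => ?_, by simp, by simp⟩
  obtain ⟨a, b, rfl⟩ := exists_int_coords hp hp4 hθ hdeg x
  rw [Matrix.range_cons_cons_empty, Submodule.mem_span_pair]
  exact ⟨a, b, by simp⟩

theorem discr_of_sq_eq_neg {K : Type*} [Field K] [NumberField K] {p : ℕ} (hp : p.Prime)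
    (hp4 : p % 4 = 1) {θ : 𝓞 K} (hθ : θ ^ 2 = -(p : 𝓞 K)) (hdeg : Module.finrank ℚ K = 2) :
    discr K = -(4 * p) := by
  obtain ⟨b, hb0, hb1⟩ := exists_ringOfIntegers_basis hp hp4 hθ hdeg
  have htr := trace_add_mul_of_sq_eq b hb0 (-p) (by rw [hb1, hθ]; simp)
  rw [hb1] at htr
  have t00 : Algebra.trace ℤ (𝓞 K) 1 = 2 := by simpa using htr 1 0
  have t01 : Algebra.trace ℤ (𝓞 K) θ = 0 := by simpa using htr 0 1
  have t11 : Algebra.trace ℤ (𝓞 K) (θ * θ) = 2 * (-p) := by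
    have := htr (-p) 0
    rw [← sq, hθ]
    simpa using this
  rw [← NumberField.discr_eq_discr K b, Algebra.discr_def, Matrix.det_fin_two]
  simp only [Algebra.traceMatrix_apply, Algebra.traceForm_apply, hb0, hb1, one_mul, mul_one,
    t00, t01, t11]
  ring

theorem infinitePlaces_of_sq_eq_neg {K : Type*} [Field K] [NumberField K] {p : ℕ} (hp : 0 < p)
    {α : K} (hα : α ^ 2 = -(p : K)) (hdeg : Module.finrank ℚ K = 2) :
    InfinitePlace.nrRealPlaces K = 0 ∧ InfinitePlace.nrComplexPlaces K = 1 := by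
  classical
  have h0 : InfinitePlace.nrRealPlaces K = 0 := by
    rw [InfinitePlace.nrRealPlaces, Fintype.card_eq_zero_iff]
    refine ⟨fun ⟨w, hw⟩ => ?_⟩
    have h := congrArg (InfinitePlace.embedding_of_isReal hw) hα
    rw [map_pow, map_neg, map_natCast] at h
    have hp' : (0 : ℝ) < p := by exact_mod_cast hp
    nlinarith [sq_nonneg (InfinitePlace.embedding_of_isReal hw α)]
  have h1 := InfinitePlace.card_add_two_mul_card_eq_rank K
  exact ⟨h0, by omega⟩

theorem regulator_eq_one_of_rank_eq_zero {K : Type*} [Field K] [NumberField K]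
    (h : Units.rank K = 0) : Units.regulator K = 1 := by
  classical
  have : IsEmpty (Fin (Units.rank K)) := by rw [h]; infer_instance
  have : IsEmpty {w : InfinitePlace K // w ≠ Units.dirichletUnitTheorem.w₀} :=
    (Units.equivFinRank K).symm.isEmpty
  rw [Units.regulator_eq_det']
  simp

theorem torsionOrder_of_sq_eq_neg {K : Type*} [Field K] [NumberField K] {p : ℕ} (hp : p.Prime)
    (hp4 : p % 4 = 1) {θ : 𝓞 K} (hθ : θ ^ 2 = -(p : 𝓞 K)) (hdeg : Module.finrank ℚ K = 2) :
    Units.torsionOrder K = 2 := by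
  classical
  have hunit : ∀ x : (𝓞 K)ˣ, x = 1 ∨ x = -1 := by
    intro x
    obtain ⟨a, b, hx⟩ := exists_int_coords hp hp4 hθ hdeg (x : 𝓞 K)
    obtain ⟨c, d, hy⟩ := exists_int_coords hp hp4 hθ hdeg ((x⁻¹ : (𝓞 K)ˣ) : 𝓞 K)
    have hxy : (x : 𝓞 K) * ((x⁻¹ : (𝓞 K)ˣ) : 𝓞 K) = 1 := x.mul_inv
    rw [hx, hy] at hxy
    have h0 : ((a * c - p * b * d - 1 : ℤ) : 𝓞 K) + ((a * d + b * c : ℤ) : 𝓞 K) * θ = 0 := by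
      push_cast
      linear_combination hxy - (b * d : 𝓞 K) * hθ
    obtain ⟨h1, h2⟩ := int_coords_unique hp.pos hθ h0
    have hnorm : (a ^ 2 + p * b ^ 2) * (c ^ 2 + p * d ^ 2) = 1 := by
      linear_combination (a * c - p * b * d + 1) * h1 + p * (a * d + b * c) * h2
    have hp' : (5 : ℤ) ≤ p := by
      have := hp.two_le
      omega
    have hpos : 0 ≤ a ^ 2 + p * b ^ 2 := by positivity
    have hone : a ^ 2 + p * b ^ 2 = 1 := Int.eq_one_of_mul_eq_one_right hpos hnorm
    have hb : b = 0 := by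
      by_contra hb
      have : 0 < b ^ 2 := by positivity
      nlinarith [sq_nonneg a]
    subst hb
    rcases (sq_eq_one_iff (a := a)).mp (by simpa using hone) with rfl | rfl
    · left; ext1; rw [hx]; simp
    · right; ext1; rw [hx]; simp
  have hneg : (-1 : (𝓞 K)ˣ) ∈ Units.torsion K :=
    (CommGroup.mem_torsion _).mpr (isOfFinOrder_iff_pow_eq_one.mpr ⟨2, by norm_num, by simp⟩)
  rw [Units.torsionOrder, Nat.card_eq_two_iff]
  refine ⟨1, ⟨-1, hneg⟩, by simp [← Subtype.coe_ne_coe], ?_⟩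
  rw [Set.eq_univ_iff_forall]
  rintro ⟨x, hx⟩
  rcases hunit x with rfl | rfl
  · left; rfl
  · right; rfl

theorem dedekindZeta_residue_of_sq_eq_neg {K : Type*} [Field K] [NumberField K] {p : ℕ}
    (hp : p.Prime) (hp4 : p % 4 = 1) {θ : 𝓞 K} (hθ : θ ^ 2 = -(p : 𝓞 K))
    (hdeg : Module.finrank ℚ K = 2) :
    dedekindZeta_residue K = Real.pi * classNumber K / (2 * Real.sqrt p) := by
  have hα : (θ : K) ^ 2 = -(p : K) := by
    have := congrArg (algebraMap (𝓞 K) K) hθ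
    simpa using this
  obtain ⟨h0, h1⟩ := infinitePlaces_of_sq_eq_neg hp.pos hα hdeg
  have hrank : Units.rank K = 0 := by
    rw [Units.rank, InfinitePlace.card_eq_nrRealPlaces_add_nrComplexPlaces, h0, h1]
  rw [dedekindZeta_residue_def, h0, h1, regulator_eq_one_of_rank_eq_zero hrank,
    torsionOrder_of_sq_eq_neg hp hp4 hθ hdeg, discr_of_sq_eq_neg hp hp4 hθ hdeg]
  have hsq : Real.sqrt |((-(4 * p) : ℤ) : ℝ)| = 2 * Real.sqrt p := by
    have : |((-(4 * p) : ℤ) : ℝ)| = 2 ^ 2 * (p : ℝ) := by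
      push_cast
      rw [abs_neg, abs_of_nonneg (by positivity)]; norm_num
    rw [this, Real.sqrt_mul (by positivity), Real.sqrt_sq (by norm_num)]
  rw [hsq]
  push_cast
  have : (0 : ℝ) < Real.sqrt p := Real.sqrt_pos.mpr (by exact_mod_cast hp.pos)
  field_simp

noncomputable def idealCount (K : Type*) [Field K] [NumberField K] (n : ℕ) : ℕ :=
  Nat.card {I : Ideal (𝓞 K) // Ideal.absNorm I = n}

theorem idealCount_one (K : Type*) [Field K] [NumberField K] : idealCount K 1 = 1 := by
  rw [idealCount, Nat.card_eq_one_iff_exists]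
  refine ⟨⟨⊤, Ideal.absNorm_top⟩, fun ⟨I, hI⟩ => ?_⟩
  exact Subtype.ext (Ideal.absNorm_eq_one_iff.mp hI)

theorem Ideal.mul_sup_span_of_coprime {R : Type*} [CommRing R] {I J : Ideal R} {m n : ℕ}
    (h : m.Coprime n) (hm : (m : R) ∈ I) (hn : (n : R) ∈ J) :
    I * J ⊔ Ideal.span {(m : R)} = I := by
  have htop : J ⊔ Ideal.span {(m : R)} = ⊤ := by
    rw [Ideal.eq_top_iff_one]
    obtain ⟨a, b, hab⟩ := (Nat.isCoprime_iff_coprime.mpr h)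
    have : (1 : R) = b * n + a * m := by
      have := congrArg (Int.cast (R := R)) hab
      push_cast at this
      rw [← this]; ring
    rw [this]
    exact Ideal.add_mem _ (Ideal.mem_sup_left (Ideal.mul_mem_left _ _ hn))
      (Ideal.mem_sup_right (Ideal.mul_mem_left _ _ (Ideal.mem_span_singleton_self _)))
  apply le_antisymm
  · exact sup_le Ideal.mul_le_left ((Ideal.span_singleton_le_iff_mem _).mpr hm)
  · calc I = I * (J ⊔ Ideal.span {(m : R)}) := by rw [htop, Ideal.mul_top]
      _ = I * J ⊔ I * Ideal.span {(m : R)} := Ideal.mul_sup _ _ _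
      _ ≤ _ := sup_le_sup_left Ideal.mul_le_right _

theorem Ideal.sup_span_mul_sup_span_of_coprime {R : Type*} [CommRing R] {L : Ideal R} {m n : ℕ}
    (h : m.Coprime n) (hmn : ((m * n : ℕ) : R) ∈ L) :
    (L ⊔ Ideal.span {(m : R)}) * (L ⊔ Ideal.span {(n : R)}) = L := by
  have htop : L ⊔ Ideal.span {(n : R)} ⊔ Ideal.span {(m : R)} = ⊤ := by
    rw [Ideal.eq_top_iff_one]
    obtain ⟨a, b, hab⟩ := (Nat.isCoprime_iff_coprime.mpr h)
    have : (1 : R) = b * n + a * m := by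
      have := congrArg (Int.cast (R := R)) hab
      push_cast at this
      rw [← this]; ring
    rw [this]
    exact Ideal.add_mem _ (Ideal.mem_sup_left (Ideal.mem_sup_right
      (Ideal.mul_mem_left _ _ (Ideal.mem_span_singleton_self _))))
      (Ideal.mem_sup_right (Ideal.mul_mem_left _ _ (Ideal.mem_span_singleton_self _)))
  have hspan : Ideal.span {(m : R)} * Ideal.span {(n : R)} ≤ L := by
    rw [Ideal.span_singleton_mul_span_singleton, Ideal.span_singleton_le_iff_mem]
    exact_mod_cast hmn
  apply le_antisymm
  · rw [Ideal.sup_mul, Ideal.mul_sup (Ideal.span {(m : R)})]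
    exact sup_le Ideal.mul_le_left (sup_le Ideal.mul_le_right hspan)
  · calc L = L * (L ⊔ Ideal.span {(n : R)} ⊔ Ideal.span {(m : R)}) := by rw [htop, Ideal.mul_top]
      _ = L * (L ⊔ Ideal.span {(n : R)}) ⊔ L * Ideal.span {(m : R)} := Ideal.mul_sup _ _ _
      _ ≤ _ := sup_le (Ideal.mul_mono_left le_sup_left) (by
          rw [mul_comm]
          exact Ideal.mul_mono le_sup_right le_sup_left)

theorem absNorm_sup_span_dvd_of_coprime {K : Type*} [Field K] [NumberField K] {m n : ℕ}
    (h : m.Coprime n) {L : Ideal (𝓞 K)} (hL : Ideal.absNorm L = m * n) :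
    Ideal.absNorm (L ⊔ Ideal.span {(m : 𝓞 K)}) ∣ m := by
  have h1 : Ideal.absNorm (L ⊔ Ideal.span {(m : 𝓞 K)}) ∣ m * n :=
    hL ▸ Ideal.absNorm_dvd_absNorm_of_le le_sup_left
  have h2 : Ideal.absNorm (L ⊔ Ideal.span {(m : 𝓞 K)}) ∣ m ^ Module.finrank ℤ (𝓞 K) := by
    rw [← Ideal.absNorm_span_natCast]
    exact Ideal.absNorm_dvd_absNorm_of_le le_sup_right
  exact (Nat.Coprime.coprime_dvd_left h2 (h.pow_left _)).dvd_of_dvd_mul_right h1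

theorem idealCount_mul_of_coprime (K : Type*) [Field K] [NumberField K] {m n : ℕ} (hm : m ≠ 0)
    (hn : n ≠ 0) (h : m.Coprime n) :
    idealCount K (m * n) = idealCount K m * idealCount K n := by
  rw [idealCount, idealCount, idealCount, ← Nat.card_prod]
  symm
  refine Nat.card_congr (Equiv.ofBijective
    (fun x => ⟨x.1.1 * x.2.1, by rw [map_mul, x.1.2, x.2.2]⟩) ⟨?_, ?_⟩)
  · rintro ⟨⟨I, hI⟩, ⟨J, hJ⟩⟩ ⟨⟨I', hI'⟩, ⟨J', hJ'⟩⟩ heq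
    have heq' : I * J = I' * J' := congrArg Subtype.val heq
    have mI : (m : 𝓞 K) ∈ I := hI ▸ Ideal.absNorm_mem I
    have mI' : (m : 𝓞 K) ∈ I' := hI' ▸ Ideal.absNorm_mem I'
    have nJ : (n : 𝓞 K) ∈ J := hJ ▸ Ideal.absNorm_mem J
    have nJ' : (n : 𝓞 K) ∈ J' := hJ' ▸ Ideal.absNorm_mem J'
    have e1 : I = I' := by
      rw [← Ideal.mul_sup_span_of_coprime h mI nJ, heq', Ideal.mul_sup_span_of_coprime h mI' nJ']
    have e2 : J = J' := by
      rw [← Ideal.mul_sup_span_of_coprime h.symm nJ mI, mul_comm, heq', mul_comm,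
        Ideal.mul_sup_span_of_coprime h.symm nJ' mI']
    subst e1 e2
    rfl
  · rintro ⟨L, hL⟩
    have hmem : ((m * n : ℕ) : 𝓞 K) ∈ L := hL ▸ Ideal.absNorm_mem L
    have hprod := Ideal.sup_span_mul_sup_span_of_coprime h hmem
    have hd1 := absNorm_sup_span_dvd_of_coprime h hL
    have hd2 := absNorm_sup_span_dvd_of_coprime h.symm (hL.trans (mul_comm _ _))
    have hN : Ideal.absNorm (L ⊔ Ideal.span {(m : 𝓞 K)}) *
        Ideal.absNorm (L ⊔ Ideal.span {(n : 𝓞 K)}) = m * n := by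
      rw [← map_mul, hprod, hL]
    have hle1 := Nat.le_of_dvd (Nat.pos_of_ne_zero hm) hd1
    have hle2 := Nat.le_of_dvd (Nat.pos_of_ne_zero hn) hd2
    have e1 : Ideal.absNorm (L ⊔ Ideal.span {(m : 𝓞 K)}) = m := by
      refine le_antisymm hle1 (le_of_mul_le_mul_right ?_ (Nat.pos_of_ne_zero hn))
      rw [← hN]
      gcongr
    have e2 : Ideal.absNorm (L ⊔ Ideal.span {(n : 𝓞 K)}) = n := by
      rw [e1] at hN
      exact Nat.eq_of_mul_eq_mul_left (Nat.pos_of_ne_zero hm) hN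
    exact ⟨⟨⟨_, e1⟩, ⟨_, e2⟩⟩, Subtype.ext hprod⟩

theorem idealCount_prime_pow_of_ramified {K : Type*} [Field K] [NumberField K] {q : ℕ}
    (hq : q.Prime) {P : Ideal (𝓞 K)} (hP : Ideal.absNorm P = q)
    (hqP : Ideal.span {(q : 𝓞 K)} = P ^ 2) (k : ℕ) : idealCount K (q ^ k) = 1 := by
  have hprime : Prime P := by
    refine Ideal.prime_of_isPrime ?_ (Ideal.isPrime_of_irreducible_absNorm (hP ▸ hq))
    rintro rfl
    rw [Ideal.absNorm_bot] at hP
    exact hq.ne_zero hP.symm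
  rw [idealCount, Nat.card_eq_one_iff_exists]
  refine ⟨⟨P ^ k, by rw [map_pow, hP]⟩, fun ⟨I, hI⟩ => Subtype.ext ?_⟩
  have hdvd : I ∣ P ^ (2 * k) := by
    rw [pow_mul, ← hqP, Ideal.span_singleton_pow, Ideal.dvd_span_singleton]
    have := Ideal.absNorm_mem I
    rw [hI] at this
    exact_mod_cast this
  obtain ⟨i, -, hi⟩ := (dvd_prime_pow hprime _).mp hdvd
  rw [associated_iff_eq] at hi
  rw [hi, map_pow, hP] at hI
  change I = P ^ k
  rw [hi, Nat.pow_right_injective hq.two_le hI]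

theorem idealCount_prime_pow_of_inert {K : Type*} [Field K] [NumberField K] {q : ℕ}
    (hq : q.Prime) (hprime : Prime (Ideal.span {(q : 𝓞 K)}))
    (hN : Ideal.absNorm (Ideal.span {(q : 𝓞 K)}) = q ^ 2) (k : ℕ) :
    idealCount K (q ^ k) = if Even k then 1 else 0 := by
  have key : ∀ I : Ideal (𝓞 K), Ideal.absNorm I = q ^ k →
      ∃ i, I = Ideal.span {(q : 𝓞 K)} ^ i ∧ k = 2 * i := by
    intro I hI
    have hdvd : I ∣ Ideal.span {(q : 𝓞 K)} ^ k := by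
      rw [Ideal.span_singleton_pow, Ideal.dvd_span_singleton]
      have := Ideal.absNorm_mem I
      rw [hI] at this
      exact_mod_cast this
    obtain ⟨i, -, hi⟩ := (dvd_prime_pow hprime _).mp hdvd
    rw [associated_iff_eq] at hi
    rw [hi, map_pow, hN, ← pow_mul] at hI
    exact ⟨i, hi, (Nat.pow_right_injective hq.two_le hI).symm⟩
  split_ifs with hk
  · obtain ⟨j, rfl⟩ := hk.exists_two_nsmul
    rw [idealCount, Nat.card_eq_one_iff_exists]
    refine ⟨⟨Ideal.span {(q : 𝓞 K)} ^ j, by rw [map_pow, hN, ← pow_mul, smul_eq_mul]⟩,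
      fun ⟨I, hI⟩ => Subtype.ext ?_⟩
    obtain ⟨i, rfl, hi⟩ := key I hI
    have : i = j := by simpa using hi.symm
    subst this
    rfl
  · rw [idealCount, Nat.card_eq_zero]
    left
    refine ⟨fun ⟨I, hI⟩ => ?_⟩
    obtain ⟨i, -, rfl⟩ := key I hI
    exact hk (even_two_mul i)

theorem idealCount_prime_pow_of_split {K : Type*} [Field K] [NumberField K] {q : ℕ}
    (hq : q.Prime) {P Q : Ideal (𝓞 K)} (hP : Ideal.absNorm P = q) (hQ : Ideal.absNorm Q = q)
    (hPQ : P ≠ Q) (hqP : Ideal.span {(q : 𝓞 K)} = P * Q) (k : ℕ) :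
    idealCount K (q ^ k) = k + 1 := by
  have hprime : ∀ P : Ideal (𝓞 K), Ideal.absNorm P = q → Prime P := by
    intro P hP
    refine Ideal.prime_of_isPrime ?_ (Ideal.isPrime_of_irreducible_absNorm (hP ▸ hq))
    rintro rfl
    rw [Ideal.absNorm_bot] at hP
    exact hq.ne_zero hP.symm
  have hinj : ∀ i j, i < j → j ≤ k → P ^ i * Q ^ (k - i) ≠ P ^ j * Q ^ (k - j) := by
    intro i j hij hjk heq
    obtain ⟨d, rfl⟩ : ∃ d, j = i + (d + 1) := ⟨j - i - 1, by omega⟩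
    rw [pow_add, mul_assoc] at heq
    have heq' := mul_left_cancel₀ (pow_ne_zero i (hprime P hP).ne_zero) heq
    have hdvd : P ∣ Q ^ (k - i) := by
      rw [heq', pow_succ', mul_assoc]
      exact dvd_mul_right _ _
    have := (hprime P hP).dvd_of_dvd_pow hdvd
    exact hPQ (associated_iff_eq.mp ((hprime P hP).associated_of_dvd (hprime Q hQ) this))
  rw [idealCount, ← Nat.card_fin (k + 1)]
  symm
  refine Nat.card_congr (Equiv.ofBijective
    (fun i : Fin (k + 1) => ⟨P ^ (i : ℕ) * Q ^ (k - i), ?_⟩) ⟨?_, ?_⟩)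
  · rw [map_mul, map_pow, map_pow, hP, hQ, ← pow_add]
    congr 1
    omega
  · intro i j hij
    have hij' : P ^ (i : ℕ) * Q ^ (k - i) = P ^ (j : ℕ) * Q ^ (k - j) := congrArg Subtype.val hij
    rcases lt_trichotomy (i : ℕ) j with h | h | h
    · exact absurd hij' (hinj i j h (by omega))
    · exact Fin.ext h
    · exact absurd hij'.symm (hinj j i h (by omega))
  · rintro ⟨I, hI⟩
    have hdvd : I ∣ P ^ k * Q ^ k := by
      rw [← mul_pow, ← hqP, Ideal.span_singleton_pow, Ideal.dvd_span_singleton]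
      have := Ideal.absNorm_mem I
      rw [hI] at this
      exact_mod_cast this
    obtain ⟨A, B, hA, hB, rfl⟩ := exists_dvd_and_dvd_of_dvd_mul hdvd
    obtain ⟨i, -, hi⟩ := (dvd_prime_pow (hprime P hP) _).mp hA
    obtain ⟨j, -, hj⟩ := (dvd_prime_pow (hprime Q hQ) _).mp hB
    rw [associated_iff_eq] at hi hj
    subst hi hj
    rw [map_mul, map_pow, map_pow, hP, hQ, ← pow_add] at hI
    have hk : i + j = k := Nat.pow_right_injective hq.two_le hI
    refine ⟨⟨i, by omega⟩, Subtype.ext ?_⟩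
    simp only
    rw [← hk, Nat.add_sub_cancel_left]

theorem absNorm_span_natCast_of_finrank_two {K : Type*} [Field K] [NumberField K]
    (hdeg : Module.finrank ℚ K = 2) (n : ℕ) :
    Ideal.absNorm (Ideal.span {(n : 𝓞 K)}) = n ^ 2 := by
  rw [Ideal.absNorm_span_natCast, RingOfIntegers.rank, hdeg]

theorem idealCount_pow_self {K : Type*} [Field K] [NumberField K] {p : ℕ} (hp : p.Prime)
    {θ : 𝓞 K} (hθ : θ ^ 2 = -(p : 𝓞 K)) (hdeg : Module.finrank ℚ K = 2) (k : ℕ) :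
    idealCount K (p ^ k) = 1 := by
  have h : Ideal.span {(p : 𝓞 K)} = Ideal.span {θ} ^ 2 := by
    rw [Ideal.span_singleton_pow, hθ, Ideal.span_singleton_neg]
  refine idealCount_prime_pow_of_ramified hp (P := Ideal.span {θ}) ?_ h k
  have hN := absNorm_span_natCast_of_finrank_two hdeg p
  rw [h, map_pow] at hN
  exact Nat.pow_left_injective (n := 2) (by norm_num) hN

theorem idealCount_two_pow {K : Type*} [Field K] [NumberField K] {p : ℕ} (hp4 : p % 4 = 1)
    {θ : 𝓞 K} (hθ : θ ^ 2 = -(p : 𝓞 K)) (hdeg : Module.finrank ℚ K = 2) (k : ℕ) :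
    idealCount K (2 ^ k) = 1 := by
  have h : Ideal.span {((2 : ℕ) : 𝓞 K)} = Ideal.span {2, 1 + θ} ^ 2 := by
    obtain ⟨r, rfl⟩ : ∃ r : ℕ, p = 4 * r + 1 := ⟨p / 4, by omega⟩
    push_cast at hθ ⊢
    rw [sq (Ideal.span _), Ideal.span_pair_mul_span_pair]
    apply le_antisymm
    · rw [Ideal.span_singleton_le_iff_mem]
      have h1 : (2 : 𝓞 K) * 2 ∈ Ideal.span {2 * 2, 2 * (1 + θ), (1 + θ) * 2, (1 + θ) * (1 + θ)} :=
        Ideal.subset_span (by simp)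
      have h2 : 2 * (1 + θ) ∈ Ideal.span {2 * 2, 2 * (1 + θ), (1 + θ) * 2, (1 + θ) * (1 + θ)} :=
        Ideal.subset_span (by simp)
      have h3 : (1 + θ) * (1 + θ) ∈
          Ideal.span {2 * 2, 2 * (1 + θ), (1 + θ) * 2, (1 + θ) * (1 + θ)} :=
        Ideal.subset_span (by simp)
      have h4 := Ideal.sub_mem _ (Ideal.sub_mem _ h2 h3) (Ideal.mul_mem_left _ (r : 𝓞 K) h1)
      convert! h4 using 1
      linear_combination hθ
    · rw [Ideal.span_le]
      rintro x (rfl | rfl | rfl | rfl) <;>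
        rw [SetLike.mem_coe, Ideal.mem_span_singleton]
      · exact dvd_mul_right _ _
      · exact dvd_mul_right _ _
      · exact dvd_mul_left _ _
      · exact ⟨θ - 2 * r, by linear_combination hθ⟩
  refine idealCount_prime_pow_of_ramified Nat.prime_two (P := Ideal.span {2, 1 + θ}) ?_ h k
  have hN := absNorm_span_natCast_of_finrank_two hdeg 2
  rw [h, map_pow] at hN
  exact Nat.pow_left_injective (n := 2) (by norm_num) hN

theorem isSquare_neg_of_absNorm_eq {K : Type*} [Field K] [NumberField K] {p q : ℕ}
    (hq : q.Prime) {θ : 𝓞 K} (hθ : θ ^ 2 = -(p : 𝓞 K)) {I : Ideal (𝓞 K)}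
    (hI : Ideal.absNorm I = q) : IsSquare (-(p : ZMod q)) := by
  have : Finite (𝓞 K ⧸ I) := (Ideal.absNorm_ne_zero_iff I).mp (hI ▸ hq.ne_zero)
  have := Fintype.ofFinite (𝓞 K ⧸ I)
  have hcard : Fintype.card (𝓞 K ⧸ I) = q := by
    rw [← Nat.card_eq_fintype_card, ← hI]
    rfl
  let e := ZMod.ringEquivOfPrime (𝓞 K ⧸ I) hq hcard
  refine ⟨e.symm (Ideal.Quotient.mk I θ), ?_⟩
  rw [← sq, ← map_pow, ← map_pow, hθ]
  simp

theorem idealCount_pow_of_not_isSquare {K : Type*} [Field K] [NumberField K] {p q : ℕ}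
    (hq : q.Prime) {θ : 𝓞 K} (hθ : θ ^ 2 = -(p : 𝓞 K)) (hdeg : Module.finrank ℚ K = 2)
    (h : ¬ IsSquare (-(p : ZMod q))) (k : ℕ) :
    idealCount K (q ^ k) = if Even k then 1 else 0 := by
  have hN := absNorm_span_natCast_of_finrank_two hdeg q
  refine idealCount_prime_pow_of_inert hq ?_ hN k
  rw [← irreducible_iff_prime]
  constructor
  · rw [Ideal.isUnit_iff, ← Ideal.absNorm_eq_one_iff, hN]
    exact (Nat.one_lt_pow (by norm_num) hq.one_lt).ne'
  · intro I J hIJ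
    rw [hIJ, map_mul] at hN
    obtain ⟨i, hi, hIq⟩ := (Nat.dvd_prime_pow hq).mp (Dvd.intro _ hN)
    rw [Ideal.isUnit_iff, Ideal.isUnit_iff, ← Ideal.absNorm_eq_one_iff,
      ← Ideal.absNorm_eq_one_iff]
    interval_cases i
    · left; simpa using hIq
    · exact absurd (isSquare_neg_of_absNorm_eq hq hθ (by simpa using hIq)) h
    · right
      rw [hIq] at hN
      exact Nat.eq_of_mul_eq_mul_left (pow_pos hq.pos 2) (by rw [hN, mul_one])

theorem span_pair_ne_top {K : Type*} [Field K] [NumberField K] {p : ℕ} (hp : p.Prime)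
    (hp4 : p % 4 = 1) {θ : 𝓞 K} (hθ : θ ^ 2 = -(p : 𝓞 K)) (hdeg : Module.finrank ℚ K = 2)
    {q : ℕ} (hq : q.Prime) {c : ℤ} (hc : (q : ℤ) ∣ c ^ 2 + p) :
    Ideal.span {(q : 𝓞 K), θ - c} ≠ ⊤ := by
  rw [Ne, Ideal.eq_top_iff_one, Ideal.mem_span_pair]
  rintro ⟨x, y, hxy⟩
  obtain ⟨x0, x1, rfl⟩ := exists_int_coords hp hp4 hθ hdeg x
  obtain ⟨y0, y1, rfl⟩ := exists_int_coords hp hp4 hθ hdeg y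
  have h0 : ((q * x0 - p * y1 - c * y0 - 1 : ℤ) : 𝓞 K) + ((q * x1 + y0 - c * y1 : ℤ) : 𝓞 K) * θ
      = 0 := by
    push_cast
    linear_combination hxy - (y1 : 𝓞 K) * hθ
  obtain ⟨h1, h2⟩ := int_coords_unique hp.pos hθ h0
  obtain ⟨m, hm⟩ := hc
  have : (q : ℤ) ∣ 1 := ⟨x0 + c * x1 - m * y1, by
    linear_combination -h1 - c * h2 - y1 * hm⟩
  exact hq.one_lt.ne' (by exact_mod_cast Int.eq_one_of_dvd_one (by positivity) this)

theorem idealCount_pow_of_isSquare {K : Type*} [Field K] [NumberField K] {p q : ℕ} (hp : p.Prime)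
    (hp4 : p % 4 = 1) (hq : q.Prime) (hq2 : q ≠ 2) (hqp : q ≠ p) {θ : 𝓞 K}
    (hθ : θ ^ 2 = -(p : 𝓞 K)) (hdeg : Module.finrank ℚ K = 2)
    (h : IsSquare (-(p : ZMod q))) (k : ℕ) : idealCount K (q ^ k) = k + 1 := by
  obtain ⟨c', hc'⟩ := h
  obtain ⟨c, rfl⟩ := ZMod.intCast_surjective c'
  have hc : (q : ℤ) ∣ c ^ 2 + p := by
    rw [← ZMod.intCast_zmod_eq_zero_iff_dvd]
    push_cast
    rw [sq, ← hc']
    ring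
  have hcop : IsCoprime (q : ℤ) (2 * c) := by
    rw [Prime.coprime_iff_not_dvd (Nat.prime_iff_prime_int.mp hq),
      (Nat.prime_iff_prime_int.mp hq).dvd_mul, not_or]
    constructor
    · intro hd
      have : q ∣ 2 := by exact_mod_cast hd
      exact hq2 ((Nat.prime_dvd_prime_iff_eq hq Nat.prime_two).mp this)
    · intro hd
      have : (q : ℤ) ∣ p := by
        have := dvd_sub hc (dvd_pow hd two_ne_zero)
        simpa using this
      exact hqp ((Nat.prime_dvd_prime_iff_eq hq hp).mp (by exact_mod_cast this))
  obtain ⟨a, b, hab⟩ := hcop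
  have habK : (a : 𝓞 K) * q + b * (2 * c) = 1 := by
    have := congrArg (Int.cast (R := 𝓞 K)) hab
    push_cast at this
    exact this
  obtain ⟨m, hm⟩ := hc
  have hmK : (c : 𝓞 K) ^ 2 + p = q * m := by
    have := congrArg (Int.cast (R := 𝓞 K)) hm
    push_cast at this
    exact this
  have hP := span_pair_ne_top hp hp4 hθ hdeg hq (c := c) ⟨m, hm⟩
  have hQ := span_pair_ne_top hp hp4 hθ hdeg hq (c := -c) ⟨m, by rw [neg_sq, hm]⟩
  have hPQ : Ideal.span {(q : 𝓞 K), θ - c} ≠ Ideal.span {(q : 𝓞 K), θ - (-c : ℤ)} := by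
    intro heq
    apply hP
    rw [Ideal.eq_top_iff_one, ← habK]
    have h1 : θ - c ∈ Ideal.span {(q : 𝓞 K), θ - c} := Ideal.subset_span (by simp)
    have h2 : θ - (-c : ℤ) ∈ Ideal.span {(q : 𝓞 K), θ - c} := by
      rw [heq]
      exact Ideal.subset_span (by simp)
    have h3 : (q : 𝓞 K) ∈ Ideal.span {(q : 𝓞 K), θ - c} := Ideal.subset_span (by simp)
    refine Ideal.add_mem _ (Ideal.mul_mem_left _ _ h3) (Ideal.mul_mem_left _ _ ?_)
    have := Ideal.sub_mem _ h2 h1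
    convert! this using 1
    push_cast
    ring
  have hprod : Ideal.span {(q : 𝓞 K)} =
      Ideal.span {(q : 𝓞 K), θ - c} * Ideal.span {(q : 𝓞 K), θ - (-c : ℤ)} := by
    rw [Ideal.span_pair_mul_span_pair]
    push_cast
    apply le_antisymm
    · rw [Ideal.span_singleton_le_iff_mem]
      set J := Ideal.span {(q : 𝓞 K) * q, q * (θ - -c), (θ - c) * q, (θ - c) * (θ - -c)} with hJ
      have h1 : (q : 𝓞 K) * q ∈ J := Ideal.subset_span (by simp)
      have h2 : (q : 𝓞 K) * (θ - -c) ∈ J := Ideal.subset_span (by simp)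
      have h3 : (θ - c) * q ∈ J := Ideal.subset_span (by simp)
      have h4 := Ideal.add_mem _ (Ideal.mul_mem_left _ (a : 𝓞 K) h1)
        (Ideal.mul_mem_left _ (b : 𝓞 K) (Ideal.sub_mem _ h2 h3))
      convert! h4 using 1
      linear_combination -(q : 𝓞 K) * habK
    · rw [Ideal.span_le]
      rintro x (rfl | rfl | rfl | rfl) <;>
        rw [SetLike.mem_coe, Ideal.mem_span_singleton]
      · exact dvd_mul_right _ _
      · exact dvd_mul_right _ _
      · exact dvd_mul_left _ _
      · exact ⟨-m, by linear_combination hθ - hmK⟩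
  have hN := absNorm_span_natCast_of_finrank_two hdeg q
  rw [hprod, map_mul] at hN
  obtain ⟨i, hi, hPi⟩ := (Nat.dvd_prime_pow hq).mp (Dvd.intro _ hN)
  have hP1 : Ideal.absNorm (Ideal.span {(q : 𝓞 K), θ - c}) = q := by
    interval_cases i
    · exact absurd (Ideal.absNorm_eq_one_iff.mp (by simpa using hPi)) hP
    · simpa using hPi
    · rw [hPi] at hN
      exact absurd (Ideal.absNorm_eq_one_iff.mp
        (Nat.eq_of_mul_eq_mul_left (pow_pos hq.pos 2) (by rw [hN, mul_one]))) hQ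
  have hQ1 : Ideal.absNorm (Ideal.span {(q : 𝓞 K), θ - (-c : ℤ)}) = q := by
    rw [hP1, sq] at hN
    exact Nat.eq_of_mul_eq_mul_left hq.pos hN
  exact idealCount_prime_pow_of_split hq hP1 hQ1 hPQ hprod k

section IdealCountFunction

open ArithmeticFunction ArithmeticFunction.zeta

noncomputable def chiFourLegendre (p : ℕ) [Fact p.Prime] : ArithmeticFunction ℤ :=
  ⟨fun n => ZMod.χ₄ n * legendreSym p n, by simp⟩

theorem chiFourLegendre_apply (p : ℕ) [Fact p.Prime] (n : ℕ) :
    chiFourLegendre p n = ZMod.χ₄ n * legendreSym p n := rfl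

theorem chiFourLegendre_mul (p : ℕ) [Fact p.Prime] (m n : ℕ) :
    chiFourLegendre p (m * n) = chiFourLegendre p m * chiFourLegendre p n := by
  simp only [chiFourLegendre_apply]
  push_cast
  rw [map_mul, legendreSym.mul]
  ring

theorem chiFourLegendre_one (p : ℕ) [Fact p.Prime] : chiFourLegendre p 1 = 1 := by
  simp [chiFourLegendre_apply]

theorem chiFourLegendre_pow (p : ℕ) [Fact p.Prime] (n k : ℕ) :
    chiFourLegendre p (n ^ k) = chiFourLegendre p n ^ k := by
  induction k with
  | zero => simp [chiFourLegendre_one]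
  | succ k ih => rw [pow_succ, pow_succ, chiFourLegendre_mul, ih]

theorem chiFourLegendre_isMultiplicative (p : ℕ) [Fact p.Prime] :
    (chiFourLegendre p).IsMultiplicative :=
  ⟨chiFourLegendre_one p, fun _ => chiFourLegendre_mul p _ _⟩

theorem chiFourLegendre_eq_legendreSym (p : ℕ) [Fact p.Prime] (hp4 : p % 4 = 1) (q : ℕ)
    [Fact q.Prime] (hq2 : q ≠ 2) : chiFourLegendre p q = legendreSym q (-p) := by
  rw [chiFourLegendre_apply, ← legendreSym.quadratic_reciprocity_one_mod_four hp4 hq2,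
    ← legendreSym.at_neg_one hq2, ← legendreSym.mul, neg_one_mul]

noncomputable def idealCountFunction (K : Type*) [Field K] [NumberField K] :
    ArithmeticFunction ℤ :=
  ⟨fun n => if n = 0 then 0 else idealCount K n, if_pos rfl⟩

theorem idealCountFunction_apply {K : Type*} [Field K] [NumberField K] {n : ℕ} (hn : n ≠ 0) :
    idealCountFunction K n = idealCount K n := if_neg hn

theorem idealCountFunction_isMultiplicative (K : Type*) [Field K] [NumberField K] :
    (idealCountFunction K).IsMultiplicative := by
  rw [IsMultiplicative.iff_ne_zero]
  refine ⟨by rw [idealCountFunction_apply one_ne_zero, idealCount_one, Nat.cast_one],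
    fun {m n} hm hn h => ?_⟩
  rw [idealCountFunction_apply hm, idealCountFunction_apply hn,
    idealCountFunction_apply (mul_ne_zero hm hn), idealCount_mul_of_coprime K hm hn h, Nat.cast_mul]

theorem idealCountFunction_eq_zeta_mul {K : Type*} [Field K] [NumberField K] {p : ℕ}
    [Fact p.Prime] (hp4 : p % 4 = 1) {θ : 𝓞 K} (hθ : θ ^ 2 = -(p : 𝓞 K))
    (hdeg : Module.finrank ℚ K = 2) :
    idealCountFunction K = (ζ : ArithmeticFunction ℤ) * chiFourLegendre p := by
  have hp : p.Prime := Fact.out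
  rw [IsMultiplicative.eq_iff_eq_on_prime_powers _ (idealCountFunction_isMultiplicative K) _
    (isMultiplicative_zeta.natCast.mul (chiFourLegendre_isMultiplicative p))]
  intro q k hq
  have : Fact q.Prime := ⟨hq⟩
  rw [idealCountFunction_apply (pow_ne_zero k hq.ne_zero), coe_zeta_mul_apply,
    Nat.sum_divisors_prime_pow hq]
  simp_rw [chiFourLegendre_pow]
  rcases eq_or_ne q 2 with rfl | hq2
  · have h0 : chiFourLegendre p 2 = 0 := by
      rw [chiFourLegendre_apply, show ZMod.χ₄ ((2 : ℕ) : ZMod 4) = 0 from rfl, zero_mul]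
    rw [idealCount_two_pow hp4 hθ hdeg, h0, Finset.sum_range_succ']
    simp
  rcases eq_or_ne q p with rfl | hqp
  · have h0 : chiFourLegendre q q = 0 := by
      rw [chiFourLegendre_apply, (legendreSym.eq_zero_iff q _).mpr (by simp), mul_zero]
    rw [idealCount_pow_self hp hθ hdeg, h0, Finset.sum_range_succ']
    simp
  rw [chiFourLegendre_eq_legendreSym p hp4 q hq2]
  by_cases h : IsSquare (-(p : ZMod q))
  · have h0 : ((-p : ℤ) : ZMod q) ≠ 0 := by
      push_cast
      rw [neg_ne_zero, Ne, ZMod.natCast_eq_zero_iff]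
      exact fun hd => hqp ((Nat.prime_dvd_prime_iff_eq hq hp).mp hd)
    rw [idealCount_pow_of_isSquare hp hp4 hq hq2 hqp hθ hdeg h,
      (legendreSym.eq_one_iff q h0).mpr (by simpa using h)]
    simp
  · rw [idealCount_pow_of_not_isSquare hq hθ hdeg h,
      (legendreSym.eq_neg_one_iff q).mpr (by simpa using h), neg_one_geom_sum]
    by_cases hk : Even k <;> simp [hk, Nat.even_add_one]

theorem dedekindZeta_eq_riemannZeta_mul {K : Type*} [Field K] [NumberField K] {p : ℕ}
    [Fact p.Prime] (hp4 : p % 4 = 1) {θ : 𝓞 K} (hθ : θ ^ 2 = -(p : 𝓞 K))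
    (hdeg : Module.finrank ℚ K = 2) {s : ℂ} (hs : 1 < s.re) :
    dedekindZeta K s = riemannZeta s *
      LSeries (fun n => ((ZMod.χ₄ n * legendreSym p n : ℤ) : ℂ)) s := by
  have h1 : dedekindZeta K s =
      LSeries (fun n => ((ζ : ArithmeticFunction ℂ) * (chiFourLegendre p : ArithmeticFunction ℂ)) n)
        s := by
    refine LSeries_congr (fun {n} hn => ?_) s
    rw [← ArithmeticFunction.coe_coe, ← intCoe_mul, ← idealCountFunction_eq_zeta_mul hp4 hθ hdeg,
      intCoe_apply, idealCountFunction_apply hn, Int.cast_natCast]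
    rfl
  rw [h1, LSeries_mul', ← LSeries_zeta_eq_riemannZeta hs]
  · rfl
  · exact LSeriesSummable_zeta_iff.mpr hs
  · refine LSeriesSummable_of_bounded_of_one_lt_re (m := 1) (fun n _ => ?_) hs
    rw [intCoe_apply, Complex.norm_intCast]
    exact_mod_cast abs_chi_four_mul_legendreSym_le_one p n

open Filter Topology in
theorem dedekindZeta_residue_eq_of_tendsto {K : Type*} [Field K] [NumberField K] {p : ℕ}
    [Fact p.Prime] (hp4 : p % 4 = 1) {θ : 𝓞 K} (hθ : θ ^ 2 = -(p : 𝓞 K))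
    (hdeg : Module.finrank ℚ K = 2) {l : ℝ}
    (hl : Tendsto (fun s : ℝ => LSeries (fun n => ((ZMod.χ₄ n * legendreSym p n : ℤ) : ℂ)) s)
      (𝓝[>] 1) (𝓝 (l : ℂ))) : dedekindZeta_residue K = l := by
  have hcast : Tendsto (fun s : ℝ => (s : ℂ)) (𝓝[>] 1) (𝓝[≠] 1) := by
    refine tendsto_nhdsWithin_iff.mpr ⟨?_, ?_⟩
    · have : ContinuousAt (fun s : ℝ => (s : ℂ)) 1 := Complex.continuous_ofReal.continuousAt
      simpa using this.tendsto.mono_left (nhdsWithin_le_nhds (s := Set.Ioi 1))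
    · filter_upwards [self_mem_nhdsWithin] with s hs
      have : s ≠ 1 := (Set.mem_Ioi.mp hs).ne'
      simpa using this
  have h := (riemannZeta_residue_one.comp hcast).mul hl
  rw [one_mul] at h
  have h' := tendsto_sub_one_mul_dedekindZeta_nhdsGT K
  refine Complex.ofReal_injective (tendsto_nhds_unique h' (h.congr' ?_))
  filter_upwards [self_mem_nhdsWithin] with s hs
  rw [dedekindZeta_eq_riemannZeta_mul hp4 hθ hdeg (by simpa using hs)]
  simp only [Function.comp_apply]
  ring

end IdealCountFunction

open scoped Classical in
/-- If `p ≡ 1 (mod 4)` is prime, then the number of integers `r` with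
`p/4 < r < p/2` that are quadratic residues mod `p` equals
`(1/4)[(p-1)/2 - h(-p)]`, where `h(-p)` is the class number of `ℚ(√-p)`. -/
theorem stmt_14 (p : ℕ) (hp : p.Prime) (hp4 : p % 4 = 1)
    (K : Type) [Field K] [NumberField K] (α : K) (hα : α ^ 2 = -(p : K))
    (hdeg : Module.finrank ℚ K = 2) :
    (4 * ((Finset.range p).filter
        (fun r => p < 4 * r ∧ 2 * r < p ∧ IsSquare (r : ZMod p))).card : ℤ) =
      ((p : ℤ) - 1) / 2 - classNumber K := by
  have : Fact p.Prime := ⟨hp⟩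
  obtain ⟨θ, hθ⟩ := exists_sq_eq_neg_ringOfIntegers hα
  obtain ⟨l, hl1, hl2⟩ := exists_limit_chi_four_mul_legendreSym p hp4
  have hres := dedekindZeta_residue_eq_of_tendsto hp4 hθ hdeg hl2
  rw [dedekindZeta_residue_of_sq_eq_neg hp hp4 hθ hdeg] at hres
  have hsum := limit_mul_sqrt p (sum_legendreSym_mul_exp_pow p hp4) l
    (cos_two_pi_mul_div_ne_zero p hp4) hl1
  rw [sum_legendreSym_mul_sign_cos p hp4, ← hres] at hsum
  have hsqrt : (0 : ℝ) < Real.sqrt p := Real.sqrt_pos.mpr (by exact_mod_cast hp.pos)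
  have hpi := Real.pi_pos
  have key : 2 * (classNumber K : ℝ) = (p - 1) - 8 * (((Finset.range p).filter
      (fun r => p < 4 * r ∧ 2 * r < p ∧ IsSquare (r : ZMod p))).card : ℝ) := by
    field_simp at hsum
    linarith
  have key' : 2 * (classNumber K : ℤ) = (p - 1) - 8 * (((Finset.range p).filter
      (fun r => p < 4 * r ∧ 2 * r < p ∧ IsSquare (r : ZMod p))).card : ℤ) := by
    exact_mod_cast key
  have main : (4 * ((Finset.range p).filter
      (fun r => p < 4 * r ∧ 2 * r < p ∧ IsSquare (r : ZMod p))).card : ℤ) =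
      ((p : ℤ) - 1) / 2 - classNumber K := by omega
  convert main
end
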